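/- There exist absolute constants C, c > 0 such that for all n ≥ C and all even q with q/4 a power of 2 and q·log n ≤ n, the following holds with probability at least 1 − n^{−c} over a random 3-tensor A with i.i.d. entries uniform on {−1,+1}: every degree-q sphere pseudo-expectation Ẽ satisfies Ẽ(f) ≤ C · n^{3/4} · (log n)^{5/2} / q^{1/4}, where f(x) = Σ_{K∈[n]^3} A_K x^K. -/

import Mathlib

open scoped BigOperators

noncomputable section

/-- The ±1-valued tensor associated with a Boolean sign pattern. -/
def signT {n d : ℕ} (A : (Fin d → Fin n) → Bool) : (Fin d → Fin n) → ℝ :=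
  fun K => if A K then 1 else -1

/-- Expectation of `g` over a random order-`d` tensor with i.i.d. uniform ±1 entries. -/
def texp (n d : ℕ) (g : ((Fin d → Fin n) → ℝ) → ℝ) : ℝ :=
  (∑ A : (Fin d → Fin n) → Bool, g (signT A)) / (Fintype.card ((Fin d → Fin n) → Bool) : ℝ)

/-- Probability of event `P` over a random order-`d` tensor with i.i.d. uniform ±1 entries. -/
def tprob (n d : ℕ) (P : ((Fin d → Fin n) → ℝ) → Prop) : ℝ :=
  (Nat.card {A : (Fin d → Fin n) → Bool // P (signT A)} : ℝ) /
    (Fintype.card ((Fin d → Fin n) → Bool) : ℝ)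

/-- Operator (ℓ₂→ℓ₂) norm of a rectangular array, as the sup of `|uᵀ M v|` over unit vectors. -/
def opNorm {ι κ : Type*} [Fintype ι] [Fintype κ] (M : ι → κ → ℝ) : ℝ :=
  sSup {r : ℝ | ∃ (u : EuclideanSpace ℝ ι) (v : EuclideanSpace ℝ κ),
    ‖u‖ = 1 ∧ ‖v‖ = 1 ∧ r = |∑ i, ∑ j, u i * M i j * v j|}

/-- Largest eigenvalue of a symmetric array, as the sup of Rayleigh quotients. -/
def lamMax {ι : Type*} [Fintype ι] (M : ι → ι → ℝ) : ℝ :=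
  sSup {r : ℝ | ∃ y : EuclideanSpace ℝ ι, ‖y‖ = 1 ∧ r = ∑ i, ∑ j, y i * M i j * y j}

/-- Number of occurrences of `v` among the coordinates of the tuple `I`. -/
def cnt {n k : ℕ} (I : Fin k → Fin n) (v : Fin n) : ℕ :=
  (Finset.univ.filter fun ℓ => I ℓ = v).card

/-- The set `O(δ)` of tuples whose multi-index is `δ`. -/
def Oset (n k : ℕ) (δ : Fin n → ℕ) : Finset (Fin k → Fin n) :=
  Finset.univ.filter fun K => ∀ v, cnt K v = δ v

/-- The set of elements of `[n]` occurring among the coordinates of `I¹, …, Iᵖ`. -/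
def occSet {n h p : ℕ} (I : Fin p → Fin h → Fin n) : Finset (Fin n) :=
  Finset.univ.filter fun v => ∃ ℓ j, I ℓ j = v

/-- Membership in the class `𝒞(c¹,…,cˢ)`: there are exactly `s` distinct occurring
elements and the `k`-th smallest occurring element appears `c k ℓ` times in `Iˡ`. -/
def inC {n h p s : ℕ} (c : Fin s → Fin p → ℕ) (I : Fin p → Fin h → Fin n) : Prop :=
  ∃ hcard : (occSet I).card = s,
    ∀ (k : Fin s) (ℓ : Fin p),
      cnt (I ℓ) (((occSet I).orderIsoOfFin hcard k : Fin n)) = c k ℓ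

/-- Concatenation of two half-tuples of length `d/2` into a tuple of length `d` (`d` even). -/
def halfConcat {n : ℕ} (d : ℕ) (hd : d % 2 = 0) (K₁ K₂ : Fin (d / 2) → Fin n) :
    Fin d → Fin n :=
  fun t => if h : (t : ℕ) < d / 2 then K₁ ⟨t, h⟩
           else K₂ ⟨(t : ℕ) - d / 2, by have ht := t.isLt; omega⟩

/-- The position in `[q/2]` of the `r`-th entry of the `m`-th block of length `d/2`. -/
def blockIdx (d q : ℕ) (m : Fin (q / d)) (r : Fin (d / 2)) : Fin (q / 2) :=
  ⟨(m : ℕ) * (d / 2) + (r : ℕ), by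
    have hm : (m : ℕ) < q / d := m.isLt
    have hr : (r : ℕ) < d / 2 := r.isLt
    have h3 : q / d * (d / 2) ≤ q / 2 := by
      have h4 : q / d * d ≤ q := Nat.div_mul_le_self q d
      have h6 : q / d * (d / 2) * 2 ≤ q / d * d := by
        have h5 : d / 2 * 2 ≤ d := by omega
        calc q / d * (d / 2) * 2 = q / d * (d / 2 * 2) := by ring
          _ ≤ q / d * d := Nat.mul_le_mul (le_refl _) h5
      omega
    have h7 : ((m : ℕ) + 1) * (d / 2) ≤ q / d * (d / 2) :=
      Nat.mul_le_mul (by omega) (le_refl _)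
    have h8 : ((m : ℕ) + 1) * (d / 2) = (m : ℕ) * (d / 2) + d / 2 := by ring
    omega⟩

/-- Row-column independent symmetrization of `A^{⊗ q/d}`. -/
def rcSym (n d q : ℕ) (hd : d % 2 = 0) (A : (Fin d → Fin n) → ℝ)
    (I J : Fin (q / 2) → Fin n) : ℝ :=
  ((Nat.factorial (q / 2) : ℝ))⁻¹ ^ 2 *
    ∑ π : Equiv.Perm (Fin (q / 2)), ∑ σ : Equiv.Perm (Fin (q / 2)),
      ∏ m : Fin (q / d),
        A (halfConcat d hd (fun r => I (π (blockIdx d q m r)))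
            (fun r => J (σ (blockIdx d q m r))))

/-- `E(I¹,…,Iᵖ) = 𝔼[∏_ℓ M[Iˡ, Iˡ⁺¹]]` (cyclically). -/
def Efun (n d q p : ℕ) (hd : d % 2 = 0) (hp : p ≠ 0)
    (I : Fin p → Fin (q / 2) → Fin n) : ℝ :=
  haveI : NeZero p := ⟨hp⟩
  texp n d fun A => ∏ ℓ : Fin p, rcSym n d q hd A (I ℓ) (I (ℓ + 1))

/-- `Tr(M^p)` for the row-column independent symmetrization `M` of `A^{⊗ q/d}`. -/
def trMpow (n d q p : ℕ) (hd : d % 2 = 0) (hp : p ≠ 0)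
    (A : (Fin d → Fin n) → ℝ) : ℝ :=
  haveI : NeZero p := ⟨hp⟩
  ∑ I : Fin p → Fin (q / 2) → Fin n, ∏ ℓ : Fin p, rcSym n d q hd A (I ℓ) (I (ℓ + 1))

/-- `𝒯 = Σ_ℓ T_ℓ ⊗ T_ℓ`, where `T_ℓ` is the symmetrized `ℓ`-th slice of the 3-tensor `A`. -/
def calT (n : ℕ) (A : (Fin 3 → Fin n) → ℝ) (u v : Fin n × Fin n) : ℝ :=
  ∑ ℓ : Fin n,
    ((A ![ℓ, u.1, v.1] + A ![ℓ, v.1, u.1]) / 2) *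
    ((A ![ℓ, u.2, v.2] + A ![ℓ, v.2, u.2]) / 2)

/-- `T = 𝒯 - D`, where `D` is the restriction of `𝒯` to entries `[(i,i),(j,j)]`. -/
def Tmat (n : ℕ) (A : (Fin 3 → Fin n) → ℝ) (u v : Fin n × Fin n) : ℝ :=
  calT n A u v - (if u.1 = u.2 ∧ v.1 = v.2 then calT n A u v else 0)

/-- The position in `[q/2]` of the `r`-th entry of the `g`-th pair. -/
def pairIdx (q : ℕ) (g : Fin (q / 4)) (r : Fin 2) : Fin (q / 2) :=
  ⟨2 * (g : ℕ) + (r : ℕ), by have hg := g.isLt; have hr := r.isLt; omega⟩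

/-- `𝖠 = T^{⊗ q/4}` as a `[n]^{q/2} × [n]^{q/2}` array. -/
def bigA3 (n q : ℕ) (A : (Fin 3 → Fin n) → ℝ) (I J : Fin (q / 2) → Fin n) : ℝ :=
  ∏ g : Fin (q / 4),
    Tmat n A (I (pairIdx q g 0), I (pairIdx q g 1)) (J (pairIdx q g 0), J (pairIdx q g 1))

/-- The row-column symmetrized matrix `B`. -/
def Bmat (n q : ℕ) (A : (Fin 3 → Fin n) → ℝ) (I J : Fin (q / 2) → Fin n) : ℝ :=
  ((Nat.factorial (q / 2) : ℝ))⁻¹ ^ 2 *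
    ∑ π : Equiv.Perm (Fin (q / 2)), ∑ σ : Equiv.Perm (Fin (q / 2)),
      bigA3 n q A (fun t => I (π t)) (fun t => J (σ t))

/-- `E(I¹,…,Iᵖ) = 𝔼[∏_ℓ B[Iˡ, Iˡ⁺¹]]` (cyclically), for the 3-tensor case. -/
def E3fun (n q p : ℕ) (hp : p ≠ 0) (I : Fin p → Fin (q / 2) → Fin n) : ℝ :=
  haveI : NeZero p := ⟨hp⟩
  texp n 3 fun A => ∏ ℓ : Fin p, Bmat n q A (I ℓ) (I (ℓ + 1))

/-- Concatenation of two tuples of length `q/2` into a tuple of length `q` (`q` even). -/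
def tupConcat {n : ℕ} (q : ℕ) (hq : q % 2 = 0) (I J : Fin (q / 2) → Fin n) :
    Fin q → Fin n :=
  fun t => if h : (t : ℕ) < q / 2 then I ⟨t, h⟩
           else J ⟨(t : ℕ) - q / 2, by have ht := t.isLt; omega⟩

end


set_option linter.unusedSectionVars false
namespace S18
open Matrix

section spectral
variable {N : Type*} [Fintype N] [DecidableEq N]

theorem spec (H : Matrix N N ℝ) (hH : Hᵀ = H) :
    ∃ (U : Matrix N N ℝ) (d : N → ℝ), Uᵀ * U = 1 ∧ U * Uᵀ = 1 ∧ H = U * diagonal d * Uᵀ := by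
  have hh : H.IsHermitian := by
    rw [Matrix.IsHermitian, Matrix.conjTranspose_eq_transpose_of_trivial, hH]
  refine ⟨(hh.eigenvectorUnitary : Matrix N N ℝ), hh.eigenvalues, ?_, ?_, ?_⟩
  · have := Unitary.coe_star_mul_self hh.eigenvectorUnitary
    rwa [Matrix.star_eq_conjTranspose, Matrix.conjTranspose_eq_transpose_of_trivial] at this
  · have := Unitary.coe_mul_star_self hh.eigenvectorUnitary
    rwa [Unitary.coe_star, Matrix.star_eq_conjTranspose, Matrix.conjTranspose_eq_transpose_of_trivial] at this
  · have := hh.spectral_theorem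
    rw [Unitary.conjStarAlgAut_apply] at this
    rw [Matrix.star_eq_conjTranspose, Matrix.conjTranspose_eq_transpose_of_trivial] at this
    simpa using this

theorem spec_pow (U : Matrix N N ℝ) (d : N → ℝ) (h1 : Uᵀ * U = 1) (h2 : U * Uᵀ = 1) (r : ℕ) :
    (U * diagonal d * Uᵀ) ^ r = U * diagonal (fun i => d i ^ r) * Uᵀ := by
  induction r with
  | zero => simp [h2]
  | succ r ih =>
    rw [pow_succ, ih]
    calc U * diagonal (fun i => d i ^ r) * Uᵀ * (U * diagonal d * Uᵀ)
        = U * diagonal (fun i => d i ^ r) * (Uᵀ * U) * diagonal d * Uᵀ := by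
          simp only [Matrix.mul_assoc]
      _ = _ := by
          rw [h1, Matrix.mul_one, Matrix.mul_assoc U, diagonal_mul_diagonal]
          simp only [pow_succ]

theorem trace_pow_eq (U : Matrix N N ℝ) (d : N → ℝ) (h1 : Uᵀ * U = 1) (h2 : U * Uᵀ = 1) (r : ℕ) :
    trace ((U * diagonal d * Uᵀ) ^ r) = ∑ i, d i ^ r := by
  rw [spec_pow U d h1 h2, Matrix.mul_assoc, trace_mul_comm, Matrix.mul_assoc, h1, Matrix.mul_one,
    trace_diagonal]

theorem trace_mul_pow_eq (U : Matrix N N ℝ) (d : N → ℝ) (h1 : Uᵀ * U = 1) (h2 : U * Uᵀ = 1)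
    (V : Matrix N N ℝ) (r : ℕ) :
    trace (V * (U * diagonal d * Uᵀ) ^ r) = ∑ i, d i ^ r * ((fun j => U j i) ⬝ᵥ (V *ᵥ (fun j => U j i))) := by
  rw [spec_pow U d h1 h2]
  have : trace (V * (U * diagonal (fun i => d i ^ r) * Uᵀ))
      = trace ((Uᵀ * V * U) * diagonal (fun i => d i ^ r)) := by
    rw [← Matrix.mul_assoc, trace_mul_comm]
    simp only [Matrix.mul_assoc]
  rw [this]
  simp only [trace, diag, mul_diagonal]
  refine Finset.sum_congr rfl fun i _ => ?_
  rw [mul_comm]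
  congr 1
  rw [Matrix.mul_assoc, Matrix.mul_apply]
  rfl

theorem unit_col (U : Matrix N N ℝ) (h1 : Uᵀ * U = 1) (i : N) :
    (fun j => U j i) ⬝ᵥ (fun j => U j i) = 1 := by
  have := congrFun (congrFun h1 i) i
  rw [Matrix.mul_apply] at this
  simpa [dotProduct] using this

theorem col_eig (U : Matrix N N ℝ) (d : N → ℝ) (h1 : Uᵀ * U = 1) (i : N) :
    (fun j => U j i) ⬝ᵥ ((U * diagonal d * Uᵀ) *ᵥ (fun j => U j i)) = d i := by
  have h : Uᵀ * (U * diagonal d * Uᵀ) * U = diagonal d := by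
    calc _ = (Uᵀ * U) * diagonal d * (Uᵀ * U) := by simp only [Matrix.mul_assoc]
      _ = _ := by simp [h1]
  have := congrFun (congrFun h i) i
  rw [Matrix.mul_assoc, Matrix.mul_apply] at this
  simp only [diagonal_apply_eq] at this
  exact this

/-- scalar pairing inequality -/
theorem pair_le (a b : ℝ) (k r : ℕ) (hr : r ≤ 2 * k) :
    a ^ r * b ^ (2 * k - r) + a ^ (2 * k - r) * b ^ r ≤ a ^ (2 * k) + b ^ (2 * k) := by
  obtain ⟨s, hs⟩ := Nat.exists_eq_add_of_le hr
  rw [hs, Nat.add_sub_cancel_left]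
  have h1 : a ^ r * b ^ s + a ^ s * b ^ r ≤ |a| ^ r * |b| ^ s + |a| ^ s * |b| ^ r := by
    refine add_le_add ?_ ?_ <;>
    · rw [← abs_pow, ← abs_pow, ← abs_mul]; exact le_abs_self _
  have h2 : a ^ (r + s) = |a| ^ (r + s) := by
    rw [← hs]; exact ((even_two_mul k).pow_abs a).symm
  have h3 : b ^ (r + s) = |b| ^ (r + s) := by
    rw [← hs]; exact ((even_two_mul k).pow_abs b).symm
  rw [h2, h3]
  have h4 : 0 ≤ (|a| ^ r - |b| ^ r) * (|a| ^ s - |b| ^ s) := by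
    rcases le_total |a| |b| with h | h
    · exact mul_nonneg_of_nonpos_of_nonpos
        (sub_nonpos.2 (pow_le_pow_left₀ (abs_nonneg _) h _))
        (sub_nonpos.2 (pow_le_pow_left₀ (abs_nonneg _) h _))
    · exact mul_nonneg
        (sub_nonneg.2 (pow_le_pow_left₀ (abs_nonneg _) h _))
        (sub_nonneg.2 (pow_le_pow_left₀ (abs_nonneg _) h _))
  rw [pow_add, pow_add]
  nlinarith [h1, h4]

theorem pair_sum_le (a b : ℝ) (k : ℕ) :
    ∑ r ∈ Finset.range (2 * k + 1), a ^ r * b ^ (2 * k - r)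
      ≤ (2 * k + 1) / 2 * (a ^ (2 * k) + b ^ (2 * k)) := by
  have h1 : ∑ r ∈ Finset.range (2 * k + 1), a ^ r * b ^ (2 * k - r)
      = ∑ r ∈ Finset.range (2 * k + 1), a ^ (2 * k - r) * b ^ r := by
    rw [← Finset.sum_range_reflect]
    refine Finset.sum_congr rfl fun r hr => ?_
    have : r ≤ 2 * k := by simpa [Nat.lt_succ_iff] using hr
    congr 2 <;> omega
  have h2 : ∑ r ∈ Finset.range (2 * k + 1), (a ^ r * b ^ (2 * k - r) + a ^ (2 * k - r) * b ^ r)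
      ≤ ∑ r ∈ Finset.range (2 * k + 1), (a ^ (2 * k) + b ^ (2 * k)) := by
    refine Finset.sum_le_sum fun r hr => pair_le a b k r ?_
    simpa [Nat.lt_succ_iff] using hr
  rw [Finset.sum_add_distrib, ← h1] at h2
  simp only [Finset.sum_const, Finset.card_range, nsmul_eq_mul] at h2
  push_cast at h2
  linarith

theorem trace_lxly (L U V : Matrix N N ℝ) (d e : N → ℝ) (hL : Lᵀ = L)
    (hU1 : Uᵀ * U = 1) (hU2 : U * Uᵀ = 1) (hV1 : Vᵀ * V = 1) (hV2 : V * Vᵀ = 1) (r s : ℕ) :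
    trace (L * (U * diagonal d * Uᵀ) ^ r * L * (V * diagonal e * Vᵀ) ^ s)
      = ∑ i, ∑ j, d i ^ r * e j ^ s * ((Uᵀ * L * V) i j) ^ 2 := by
  rw [spec_pow U d hU1 hU2, spec_pow V e hV1 hV2]
  set D := diagonal (fun i => d i ^ r)
  set E := diagonal (fun i => e i ^ s)
  have h1 : trace (L * (U * D * Uᵀ) * L * (V * E * Vᵀ))
      = trace ((Uᵀ * L * V)ᵀ * (D * (Uᵀ * L * V) * E)) := by
    rw [transpose_mul, transpose_mul, transpose_transpose, hL]
    have : L * (U * D * Uᵀ) * L * (V * E * Vᵀ) = (L * U * D * Uᵀ * L * V * E) * Vᵀ := by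
      simp only [Matrix.mul_assoc]
    rw [this, trace_mul_comm]
    simp only [Matrix.mul_assoc]
  rw [h1]
  simp only [trace, diag, Matrix.mul_apply (M := (Uᵀ * L * V)ᵀ), transpose_apply, D, E, mul_diagonal,
    diagonal_mul]
  rw [Finset.sum_comm]
  refine Finset.sum_congr rfl fun i _ => Finset.sum_congr rfl fun j _ => ?_
  ring

theorem amgm (L x y : Matrix N N ℝ) (hL : Lᵀ = L) (hx : xᵀ = x) (hy : yᵀ = y) (k : ℕ) :
    ∑ r ∈ Finset.range (2 * k + 1), trace (L * x ^ r * L * y ^ (2 * k - r))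
      ≤ (2 * k + 1) / 2 * (trace (L * L * x ^ (2 * k)) + trace (L * L * y ^ (2 * k))) := by
  obtain ⟨U, d, hU1, hU2, rfl⟩ := spec x hx
  obtain ⟨V, e, hV1, hV2, rfl⟩ := spec y hy
  have hx' := trace_lxly L U V d e hL hU1 hU2 hV1 hV2 (2 * k) 0
  have hy' := trace_lxly L U V d e hL hU1 hU2 hV1 hV2 0 (2 * k)
  rw [pow_zero, Matrix.mul_one, trace_mul_comm, ← Matrix.mul_assoc] at hx'
  rw [pow_zero, Matrix.mul_one] at hy'
  rw [hx', hy']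
  simp only [trace_lxly L U V d e hL hU1 hU2 hV1 hV2]
  rw [Finset.sum_comm, ← Finset.sum_add_distrib, Finset.mul_sum]
  refine Finset.sum_le_sum fun i _ => ?_
  rw [Finset.sum_comm, ← Finset.sum_add_distrib, Finset.mul_sum]
  refine Finset.sum_le_sum fun j _ => ?_
  have := mul_le_mul_of_nonneg_right (pair_sum_le (d i) (e j) k) (sq_nonneg ((Uᵀ * L * V) i j))
  rw [Finset.sum_mul] at this
  simp only [pow_zero, one_mul, mul_one]
  linarith

end spectral

section chaos
variable {N : Type*} [Fintype N] [DecidableEq N]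
variable {κ : Type*} [Fintype κ] [DecidableEq κ]

/-- signs -/
def sg (A : κ → Bool) (a : κ) : ℝ := if A a then 1 else -1

theorem sg_mul_self (A : κ → Bool) (a : κ) : sg A a * sg A a = 1 := by
  unfold sg; split_ifs <;> norm_num

/-- flip one sign -/
def flip (a : κ) (A : κ → Bool) : κ → Bool := Function.update A a (!A a)

theorem flip_flip (a : κ) (A : κ → Bool) : flip a (flip a A) = A := by
  unfold flip
  ext b
  by_cases h : b = a <;> simp [h]

theorem sum_flip (a : κ) (g : (κ → Bool) → ℝ) : ∑ A, g (flip a A) = ∑ A, g A :=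
  Function.Bijective.sum_comp (Function.Involutive.bijective (flip_flip a)) g

theorem sg_flip_self (a : κ) (A : κ → Bool) : sg (flip a A) a = - sg A a := by
  unfold sg flip
  cases h : A a <;> simp [h]

theorem sg_flip_ne (a b : κ) (h : b ≠ a) (A : κ → Bool) : sg (flip a A) b = sg A b := by
  unfold sg flip
  simp [h]

variable (X : κ → κ → Matrix N N ℝ)

/-- the linear coefficient -/
def Lc (A : κ → Bool) (a : κ) : Matrix N N ℝ := ∑ b, sg A b • X a b
/-- the chaos -/
def Hc (A : κ → Bool) : Matrix N N ℝ := ∑ a, sg A a • Lc X A a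

theorem Lc_flip (h0 : ∀ a, X a a = 0) (A : κ → Bool) (a : κ) : Lc X (flip a A) a = Lc X A a := by
  unfold Lc
  refine Finset.sum_congr rfl fun b _ => ?_
  by_cases h : b = a
  · subst h; simp [h0]
  · rw [sg_flip_ne a b h]

theorem Hc_flip (h0 : ∀ a, X a a = 0) (hs : ∀ a b, X a b = X b a) (A : κ → Bool) (a : κ) :
    Hc X A - Hc X (flip a A) = (4 * sg A a) • Lc X A a := by
  have hsg : ∀ b, sg (flip a A) b = sg A b - (if b = a then 2 * sg A a else 0) := by
    intro b
    by_cases h : b = a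
    · subst h; rw [sg_flip_self]; simp; ring
    · rw [sg_flip_ne a b h]; simp [h]
  have hL : ∀ c, Lc X (flip a A) c = Lc X A c - (2 * sg A a) • X c a := by
    intro c
    unfold Lc
    simp [hsg, sub_smul, Finset.sum_sub_distrib, ite_smul]
  have h1 : Hc X (flip a A) = Hc X A - (2 * sg A a) • Lc X A a - (2 * sg A a) • Lc X A a := by
    have e1 : Hc X (flip a A) = ∑ c, sg A c • Lc X (flip a A) c
        - (2 * sg A a) • Lc X (flip a A) a := by
      unfold Hc
      simp [hsg, sub_smul, Finset.sum_sub_distrib, ite_smul]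
    rw [e1, Lc_flip X h0]
    congr 1
    simp only [hL, smul_sub, Finset.sum_sub_distrib]
    rw [Hc]
    congr 1
    rw [Lc, Finset.smul_sum]
    refine Finset.sum_congr rfl fun c _ => ?_
    rw [hs a c]
    module
  rw [h1]
  module

theorem Lc_symm (ht : ∀ a b, (X a b)ᵀ = X a b) (A : κ → Bool) (a : κ) :
    (Lc X A a)ᵀ = Lc X A a := by
  unfold Lc
  rw [transpose_sum]
  simp [ht]

theorem Hc_symm (ht : ∀ a b, (X a b)ᵀ = X a b) (A : κ → Bool) :
    (Hc X A)ᵀ = Hc X A := by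
  unfold Hc
  rw [transpose_sum]
  simp [Lc_symm X ht]

theorem pow_sub_tele (x y : Matrix N N ℝ) (k : ℕ) :
    x ^ k - y ^ k = ∑ r ∈ Finset.range k, x ^ r * (x - y) * y ^ (k - 1 - r) := by
  induction k with
  | zero => simp
  | succ k ih =>
    rw [Finset.sum_range_succ]
    have : ∑ r ∈ Finset.range k, x ^ r * (x - y) * y ^ (k + 1 - 1 - r)
        = (∑ r ∈ Finset.range k, x ^ r * (x - y) * y ^ (k - 1 - r)) * y := by
      rw [Finset.sum_mul]
      refine Finset.sum_congr rfl fun r hr => ?_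
      have hr' := Finset.mem_range.1 hr
      have : k + 1 - 1 - r = (k - 1 - r) + 1 := by omega
      rw [this, pow_succ]
      simp only [Matrix.mul_assoc]
    rw [this, ← ih]
    simp only [Nat.add_sub_cancel, Nat.sub_self, pow_zero, mul_one, pow_succ, sub_mul, mul_sub]
    abel

theorem ibp (h0 : ∀ a, X a a = 0) (hs : ∀ a b, X a b = X b a) (ht : ∀ a b, (X a b)ᵀ = X a b)
    (k : ℕ) :
    ∑ A, trace (Hc X A ^ (2 * (k + 1)))
      ≤ 2 * (2 * k + 1) * ∑ A, trace ((∑ a, Lc X A a * Lc X A a) * Hc X A ^ (2 * k)) := by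
  have key : ∀ a, ∑ A, sg A a * trace (Lc X A a * Hc X A ^ (2 * k + 1))
      ≤ 2 * (2 * k + 1) * ∑ A, trace (Lc X A a * Lc X A a * Hc X A ^ (2 * k)) := by
    intro a
    have e1 : ∑ A, sg A a * trace (Lc X A a * Hc X A ^ (2 * k + 1))
        = - ∑ A, sg A a * trace (Lc X A a * Hc X (flip a A) ^ (2 * k + 1)) := by
      rw [← sum_flip a, ← Finset.sum_neg_distrib]
      refine Finset.sum_congr rfl fun A _ => ?_
      rw [sg_flip_self, Lc_flip X h0]
      ring
    have e2 : ∀ A, sg A a * trace (Lc X A a * Hc X A ^ (2 * k + 1))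
        - sg A a * trace (Lc X A a * Hc X (flip a A) ^ (2 * k + 1))
        ≤ 2 * (2 * k + 1) * (trace (Lc X A a * Lc X A a * Hc X A ^ (2 * k))
          + trace (Lc X A a * Lc X A a * Hc X (flip a A) ^ (2 * k))) := by
      intro A
      rw [← mul_sub, ← trace_sub, ← mul_sub, pow_sub_tele, Hc_flip X h0 hs, Finset.mul_sum,
        trace_sum, Finset.mul_sum]
      have := amgm (Lc X A a) (Hc X A) (Hc X (flip a A)) (Lc_symm X ht A a) (Hc_symm X ht A)
        (Hc_symm X ht _) k
      have e3 : ∑ r ∈ Finset.range (2 * k + 1), sg A a * trace (Lc X A a * (Hc X A ^ r *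
            ((4 * sg A a) • Lc X A a) * Hc X (flip a A) ^ (2 * k + 1 - 1 - r)))
          = 4 * ∑ r ∈ Finset.range (2 * k + 1), trace (Lc X A a * Hc X A ^ r * Lc X A a *
            Hc X (flip a A) ^ (2 * k - r)) := by
        rw [Finset.mul_sum]
        refine Finset.sum_congr rfl fun r _ => ?_
        rw [Nat.add_sub_cancel, mul_smul_comm, smul_mul_assoc, mul_smul_comm, trace_smul,
          smul_eq_mul]
        simp only [Matrix.mul_assoc]
        linear_combination 4 * trace (Lc X A a * (Hc X A ^ r * (Lc X A a *
            Hc X (flip a A) ^ (2 * k - r)))) * sg_mul_self A a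
      rw [e3]
      linarith
    have e4 := Finset.sum_le_sum fun A (_ : A ∈ Finset.univ) => e2 A
    rw [Finset.sum_sub_distrib, ← Finset.mul_sum, Finset.sum_add_distrib] at e4
    have e5 : ∑ A, trace (Lc X A a * Lc X A a * Hc X (flip a A) ^ (2 * k))
        = ∑ A, trace (Lc X A a * Lc X A a * Hc X A ^ (2 * k)) := by
      rw [← sum_flip a]
      refine Finset.sum_congr rfl fun A _ => ?_
      rw [Lc_flip X h0, flip_flip]
    rw [e5] at e4
    linarith
  have h1 : ∀ A, trace (Hc X A ^ (2 * (k + 1)))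
      = ∑ a, sg A a * trace (Lc X A a * Hc X A ^ (2 * k + 1)) := by
    intro A
    rw [show 2 * (k + 1) = 2 * k + 1 + 1 by ring, pow_succ']
    conv_lhs => rw [Hc, Finset.sum_mul, trace_sum]
    refine Finset.sum_congr rfl fun a _ => ?_
    rw [smul_mul_assoc, trace_smul, smul_eq_mul]
    rfl
  simp only [h1, Finset.sum_mul, trace_sum]
  rw [Finset.sum_comm, Finset.sum_comm (s := (Finset.univ : Finset (κ → Bool))), Finset.mul_sum]
  exact Finset.sum_le_sum fun a _ => key a

theorem scal1 (c s : ℝ) (hc : 0 ≤ c) (hs : 0 ≤ s) (k : ℕ) :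
    c * s ^ k ≤ s ^ (k + 1) / 4 + (4 * c) ^ (k + 1) := by
  rcases le_total (4 * c) s with h | h
  · have : c * s ^ k ≤ s / 4 * s ^ k := by gcongr; linarith
    have h2 : 0 ≤ (4 * c) ^ (k + 1) := by positivity
    rw [pow_succ]; linarith
  · have h1 : c * s ^ k ≤ c * (4 * c) ^ k := by gcongr
    have h2 : 0 ≤ s ^ (k + 1) := by positivity
    have h3 : 0 ≤ c * (4 * c) ^ k := by positivity
    rw [pow_succ (4 * c)]; linarith

/-- closing lemma -/
theorem closing (h0 : ∀ a, X a a = 0) (hs : ∀ a b, X a b = X b a) (ht : ∀ a b, (X a b)ᵀ = X a b)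
    (c : (κ → Bool) → ℝ) (v1 : ℝ) (hc : ∀ A, 0 ≤ c A) (hv1 : 0 ≤ v1)
    (hV : ∀ A (v : N → ℝ), ∑ a, (Lc X A a *ᵥ v) ⬝ᵥ (Lc X A a *ᵥ v)
      ≤ c A * (v ⬝ᵥ v) + v1 * (v ⬝ᵥ (Hc X A *ᵥ v)))
    (p : ℕ) (hp : 1 ≤ p) :
    ∑ A, trace (Hc X A ^ (2 * p))
      ≤ 2 * Fintype.card N * ∑ A, ((16 * p * c A) ^ p + (16 * p * v1) ^ (2 * p)) := by
  obtain ⟨k, rfl⟩ : ∃ k, p = k + 1 := ⟨p - 1, by omega⟩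
  have h1 := ibp X h0 hs ht k
  have h2 : ∀ A, 2 * (2 * k + 1) * trace ((∑ a, Lc X A a * Lc X A a) * Hc X A ^ (2 * k))
      ≤ trace (Hc X A ^ (2 * (k + 1))) / 2 + Fintype.card N * ((16 * (k + 1 : ℕ) * c A) ^ (k + 1)
        + (16 * (k + 1 : ℕ) * v1) ^ (2 * (k + 1))) := by
    intro A
    have hL : ∀ v : N → ℝ, v ⬝ᵥ ((∑ a, Lc X A a * Lc X A a) *ᵥ v)
        = ∑ a, (Lc X A a *ᵥ v) ⬝ᵥ (Lc X A a *ᵥ v) := by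
      intro v
      rw [Matrix.sum_mulVec, dotProduct_sum]
      refine Finset.sum_congr rfl fun a _ => ?_
      rw [← Matrix.mulVec_mulVec, dotProduct_mulVec, ← Matrix.mulVec_transpose, Lc_symm X ht]
    have hVA := hV A
    simp only [← hL] at hVA
    generalize hV' : (∑ a, Lc X A a * Lc X A a) = V at *
    have hHs := Hc_symm X ht A
    generalize Hc X A = H at *
    obtain ⟨U, d, hU1, hU2, rfl⟩ := spec H hHs
    rw [trace_mul_pow_eq U d hU1 hU2, trace_pow_eq U d hU1 hU2, Finset.mul_sum, Finset.sum_div,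
      ← nsmul_eq_mul, Fintype.card, ← Finset.sum_const, ← Finset.sum_add_distrib]
    refine Finset.sum_le_sum fun i _ => ?_
    have h3 := hVA (fun j => U j i)
    rw [unit_col U hU1, col_eig U d hU1] at h3
    have hk : (0 : ℝ) ≤ k := Nat.cast_nonneg k
    have hsq : 0 ≤ d i ^ (2 * k) := by rw [pow_mul]; positivity
    have h4 : d i ^ (2 * k) * ((fun j => U j i) ⬝ᵥ (V *ᵥ fun j => U j i))
        ≤ d i ^ (2 * k) * (c A * 1 + v1 * |d i|) := by
      refine mul_le_mul_of_nonneg_left (h3.trans ?_) hsq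
      gcongr
      exact le_abs_self _
    have e1 : d i ^ (2 * k) = |d i| ^ (2 * k) := ((even_two_mul k).pow_abs _).symm
    have e2 : d i ^ (2 * (k + 1)) = |d i| ^ (2 * (k + 1)) := ((even_two_mul _).pow_abs _).symm
    have h5 := scal1 (4 * (k + 1) * c A) (|d i| ^ 2) (by have := hc A; positivity) (by positivity) k
    have h6 := scal1 (4 * (k + 1) * v1) (|d i|) (by positivity) (by positivity) (2 * k + 1)
    rw [← pow_mul, ← pow_mul] at h5
    rw [show 2 * k + 1 + 1 = 2 * (k + 1) by ring] at h6
    push_cast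
    rw [show 4 * (4 * ((k : ℝ) + 1) * c A) = 16 * (k + 1) * c A by ring] at h5
    rw [show 4 * (4 * ((k : ℝ) + 1) * v1) = 16 * (k + 1) * v1 by ring] at h6
    rw [e1] at h4 ⊢
    rw [e2]
    have h7 : 0 ≤ |d i| ^ (2 * k) * (c A * 1 + v1 * |d i|) := by have := hc A; positivity
    calc 2 * (2 * (k : ℝ) + 1) * (|d i| ^ (2 * k) * ((fun j => U j i) ⬝ᵥ (V *ᵥ fun j => U j i)))
        ≤ 2 * (2 * (k : ℝ) + 1) * (|d i| ^ (2 * k) * (c A * 1 + v1 * |d i|)) := by gcongr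
      _ ≤ 4 * (k + 1) * (|d i| ^ (2 * k) * (c A * 1 + v1 * |d i|)) := by nlinarith
      _ = 4 * (k + 1) * c A * |d i| ^ (2 * k) + 4 * (k + 1) * v1 * |d i| ^ (2 * k + 1) := by ring
      _ ≤ _ := by linarith
  have h3 := Finset.sum_le_sum fun A (_ : A ∈ Finset.univ) => h2 A
  rw [← Finset.mul_sum, Finset.sum_add_distrib, ← Finset.sum_div, ← Finset.mul_sum] at h3
  linarith

end chaos
end S18

namespace S18
open Matrix

section ns
variable {N : Type*} [Fintype N] [DecidableEq N]

/-- squared Euclidean norm -/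
def ns (v : N → ℝ) : ℝ := v ⬝ᵥ v

theorem ns_eq (v : N → ℝ) : ns v = ∑ i, v i ^ 2 := by
  simp [ns, dotProduct, sq]

theorem ns_nonneg (v : N → ℝ) : 0 ≤ ns v := by
  rw [ns_eq]; positivity

theorem ns_add (x y : N → ℝ) : ns (x + y) = ns x + 2 * (x ⬝ᵥ y) + ns y := by
  simp only [ns, add_dotProduct, dotProduct_add, dotProduct_comm y x]; ring

theorem ns_sub (x y : N → ℝ) : ns (x - y) = ns x - 2 * (x ⬝ᵥ y) + ns y := by
  simp only [ns, sub_dotProduct, dotProduct_sub, dotProduct_comm y x]; ring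

theorem ns_smul (c : ℝ) (x : N → ℝ) : ns (c • x) = c ^ 2 * ns x := by
  simp only [ns, smul_dotProduct, dotProduct_smul, smul_eq_mul]; ring

theorem dot_le (x y : N → ℝ) : x ⬝ᵥ y ≤ (ns x + ns y) / 2 := by
  have := ns_nonneg (x - y); rw [ns_sub] at this; linarith

theorem ns_add_le (x y : N → ℝ) : ns (x + y) ≤ 2 * ns x + 2 * ns y := by
  rw [ns_add]; have := dot_le x y; linarith

theorem ns_sub_le (x y : N → ℝ) : ns (x - y) ≤ 2 * ns x + 2 * ns y := by
  rw [ns_sub]; have := ns_nonneg (x + y); rw [ns_add] at this; linarith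

theorem ns_half (x y : N → ℝ) : ns ((1 / 2 : ℝ) • (x + y)) ≤ (ns x + ns y) / 2 := by
  rw [ns_smul]; have := ns_add_le x y; linarith

theorem ns_sum_le {T : Type*} [Fintype T] (x : T → N → ℝ) :
    ns (∑ t, x t) ≤ Fintype.card T * ∑ t, ns (x t) := by
  simp only [ns_eq]
  rw [Finset.sum_comm, Finset.mul_sum]
  refine Finset.sum_le_sum fun i _ => ?_
  rw [Finset.sum_apply]
  simpa using (sq_sum_le_card_mul_sum_sq (s := Finset.univ) (f := fun t => x t i))

theorem ns_mulVec (M : Matrix N N ℝ) (v : N → ℝ) : ns (M *ᵥ v) = v ⬝ᵥ ((Mᵀ * M) *ᵥ v) := by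
  rw [ns, ← Matrix.mulVec_mulVec, dotProduct_mulVec, dotProduct_comm, dotProduct_mulVec,
    dotProduct_mulVec, vecMul_transpose, dotProduct_comm, ← dotProduct_mulVec]

theorem dot_mulVec_mulVec (M P : Matrix N N ℝ) (v u : N → ℝ) :
    (M *ᵥ v) ⬝ᵥ (P *ᵥ u) = v ⬝ᵥ ((Mᵀ * P) *ᵥ u) := by
  rw [← Matrix.mulVec_mulVec, dotProduct_mulVec v, vecMul_transpose]

theorem ns_mulVec_symm (M : Matrix N N ℝ) (hM : Mᵀ = M) (v : N → ℝ) :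
    ns (M *ᵥ v) = v ⬝ᵥ ((M * M) *ᵥ v) := by
  rw [ns_mulVec, hM]
end ns

section phi
variable {N : Type*} [Fintype N] [DecidableEq N] {n : ℕ}
variable {T : Type*} [Fintype T] [DecidableEq T]

/-- elementary matrices -/
abbrev El (i k : Fin n) : Matrix (Fin n) (Fin n) ℝ := single i k 1

/-- symmetrized elementary matrices -/
noncomputable def sE (i k : Fin n) : Matrix (Fin n) (Fin n) ℝ := (1 / 2 : ℝ) • (El i k + El k i)

theorem El_mul (i j k l : Fin n) : El i j * El k l = if j = k then El i l else 0 := by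
  split_ifs with h
  · subst h; simp [El]
  · simp [El, h]

theorem sum_El : ∑ i : Fin n, El i i = 1 := by
  ext a b
  rw [Matrix.sum_apply, Matrix.one_apply]
  simp only [El, Matrix.single_apply]
  by_cases h : a = b
  · subst h; simp
  · rw [if_neg h]
    refine Finset.sum_eq_zero fun i _ => ?_
    rw [if_neg]; rintro ⟨h1, h2⟩; exact h (h1.symm.trans h2)

theorem sE_symm (i k : Fin n) : (sE i k)ᵀ = sE i k := by
  simp [sE, El, add_comm]

variable (φ : T → (Matrix (Fin n) (Fin n) ℝ →ₐ[ℝ] Matrix N N ℝ))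

/-- the swap -/
def Kts (t s : T) : Matrix N N ℝ := ∑ i, ∑ k, φ t (El k i) * φ s (El i k)

theorem Kts_diag (t : T) : Kts φ t t = (n : ℝ) • (1 : Matrix N N ℝ) := by
  unfold Kts
  simp only [← map_mul, El_mul, if_true]
  simp only [← map_sum, sum_El, map_one]
  simp [Nat.cast_smul_eq_nsmul]

theorem Kts_sq (hc : ∀ t s, t ≠ s → ∀ M P, φ t M * φ s P = φ s P * φ t M) (t s : T) (h : t ≠ s) :
    Kts φ t s * Kts φ t s = 1 := by
  unfold Kts
  simp only [Finset.sum_mul, Finset.mul_sum]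
  have : ∀ i k j l, φ t (El k i) * φ s (El i k) * (φ t (El l j) * φ s (El j l))
      = if i = l then (if k = j then φ t (El k k) * φ s (El i i) else 0) else 0 := by
    intro i k j l
    calc _ = φ t (El k i) * (φ s (El i k) * φ t (El l j)) * φ s (El j l) := by
          simp only [Matrix.mul_assoc]
      _ = φ t (El k i) * (φ t (El l j) * φ s (El i k)) * φ s (El j l) := by
          rw [hc t s h]
      _ = (φ t (El k i) * φ t (El l j)) * (φ s (El i k) * φ s (El j l)) := by
          simp only [Matrix.mul_assoc]
      _ = _ := by
          rw [← map_mul, ← map_mul, El_mul, El_mul]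
          by_cases h1 : i = l
          · by_cases h2 : k = j
            · subst h1 h2; simp
            · simp [h1, h2]
          · simp [h1]
  simp only [this]
  have h2 : ∀ j l : Fin n, (∑ i, ∑ k, if i = l then (if k = j then φ t (El k k) * φ s (El i i) else 0) else 0)
      = φ t (El j j) * φ s (El l l) := by
    intro j l
    rw [Finset.sum_eq_single l]
    · simp
    · intro b _ hb; simp [hb]
    · simp
  simp only [h2]
  calc _ = ∑ i, ∑ k, φ t (El i i) * φ s (El k k) := rfl
    _ = (∑ k, φ t (El k k)) * (∑ i, φ s (El i i)) := by
        rw [Finset.sum_mul_sum]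
    _ = 1 := by rw [← map_sum, ← map_sum, sum_El, map_one, map_one, one_mul]

theorem Kts_symm (hc : ∀ t s, t ≠ s → ∀ M P, φ t M * φ s P = φ s P * φ t M)
    (hT : ∀ t M, φ t Mᵀ = (φ t M)ᵀ) (t s : T) (h : t ≠ s) :
    (Kts φ t s)ᵀ = Kts φ t s := by
  unfold Kts
  simp only [transpose_sum, transpose_mul, ← hT]
  rw [Finset.sum_comm]
  refine Finset.sum_congr rfl fun i _ => Finset.sum_congr rfl fun k _ => ?_
  rw [hc t s h]
  simp [El]

theorem sumZ (hc : ∀ t s, t ≠ s → ∀ M P, φ t M * φ s P = φ s P * φ t M)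
    (hT : ∀ t M, φ t Mᵀ = (φ t M)ᵀ) (u : T → N → ℝ) :
    ∑ i, ∑ k, ns (∑ t, φ t (El i k) *ᵥ u t) ≤ (n + Fintype.card T) * ∑ t, ns (u t) := by
  have h1 : ∑ i, ∑ k, ns (∑ t, φ t (El i k) *ᵥ u t) = ∑ t, ∑ s, u t ⬝ᵥ (Kts φ t s *ᵥ u s) := by
    have : ∀ i k, ns (∑ t, φ t (El i k) *ᵥ u t)
        = ∑ t, ∑ s, u t ⬝ᵥ ((φ t (El k i) * φ s (El i k)) *ᵥ u s) := by
      intro i k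
      unfold ns
      rw [sum_dotProduct]
      refine Finset.sum_congr rfl fun t _ => ?_
      rw [dotProduct_sum]
      refine Finset.sum_congr rfl fun s _ => ?_
      rw [dot_mulVec_mulVec, ← hT]
      simp [El]
    simp only [this]
    have h2 : ∀ t s, u t ⬝ᵥ (Kts φ t s *ᵥ u s)
        = ∑ i, ∑ k, u t ⬝ᵥ ((φ t (El k i) * φ s (El i k)) *ᵥ u s) := by
      intro t s
      simp only [Kts, Matrix.sum_mulVec, dotProduct_sum]
    simp only [h2]
    rw [Finset.sum_congr rfl fun i _ => Finset.sum_comm]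
    rw [Finset.sum_comm]
    refine Finset.sum_congr rfl fun t _ => ?_
    rw [Finset.sum_congr rfl fun i _ => Finset.sum_comm]
    rw [Finset.sum_comm]
  have h2 : ∀ t s, u t ⬝ᵥ (Kts φ t s *ᵥ u s)
      ≤ (if t = s then n * ns (u t) else 0) + (ns (u t) + ns (u s)) / 2 := by
    intro t s
    by_cases h : t = s
    · subst h
      rw [Kts_diag, if_pos rfl, Matrix.smul_mulVec, Matrix.one_mulVec, dotProduct_smul, smul_eq_mul]
      have := ns_nonneg (u t)
      change n * ns (u t) ≤ _
      linarith
    · rw [if_neg h, zero_add]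
      refine (dot_le _ _).trans (le_of_eq ?_)
      rw [ns_mulVec_symm _ (Kts_symm φ hc hT t s h), Kts_sq φ hc t s h, Matrix.one_mulVec]
      rfl
  rw [h1]
  refine (Finset.sum_le_sum fun t _ => Finset.sum_le_sum fun s _ => h2 t s).trans (le_of_eq ?_)
  simp only [Finset.sum_add_distrib, ← Finset.sum_div, Finset.sum_ite_eq, Finset.mem_univ, if_true,
    Finset.sum_const, Finset.card_univ, nsmul_eq_mul, ← Finset.mul_sum]
  ring

theorem sumY (hc : ∀ t s, t ≠ s → ∀ M P, φ t M * φ s P = φ s P * φ t M)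
    (hT : ∀ t M, φ t Mᵀ = (φ t M)ᵀ) (u : T → N → ℝ) :
    ∑ i, ∑ k, ns (∑ t, φ t (sE i k) *ᵥ u t) ≤ (n + Fintype.card T) * ∑ t, ns (u t) := by
  have h := sumZ φ hc hT u
  have h1 : ∀ i k, ns (∑ t, φ t (sE i k) *ᵥ u t)
      ≤ (ns (∑ t, φ t (El i k) *ᵥ u t) + ns (∑ t, φ t (El k i) *ᵥ u t)) / 2 := by
    intro i k
    refine le_trans (le_of_eq ?_) (ns_half _ _)
    congr 1
    rw [← Finset.sum_add_distrib, Finset.smul_sum]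
    refine Finset.sum_congr rfl fun t _ => ?_
    rw [sE, map_smul, map_add, Matrix.smul_mulVec, Matrix.add_mulVec]
  refine (Finset.sum_le_sum fun i _ => Finset.sum_le_sum fun k _ => h1 i k).trans ?_
  simp only [← Finset.sum_div, Finset.sum_add_distrib]
  rw [Finset.sum_comm (f := fun i k => ns (∑ t, φ t (El k i) *ᵥ u t))]
  linarith

theorem El_contr (hT : ∀ t M, φ t Mᵀ = (φ t M)ᵀ) (t : T) (i k : Fin n) (v : N → ℝ) :
    ns (φ t (El i k) *ᵥ v) ≤ ns v := by
  have e : ns (φ t (El i k) *ᵥ v) = v ⬝ᵥ (φ t (El k k) *ᵥ v) := by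
    rw [ns_mulVec, ← hT, ← map_mul]
    simp [El]
  have e2 : ns (φ t (El k k) *ᵥ v) = v ⬝ᵥ (φ t (El k k) *ᵥ v) := by
    rw [ns_mulVec, ← hT, ← map_mul]
    simp [El]
  have := dot_le v (φ t (El k k) *ᵥ v)
  rw [e2] at this
  rw [e]; linarith

theorem sE_contr (hT : ∀ t M, φ t Mᵀ = (φ t M)ᵀ) (t : T) (i k : Fin n) (v : N → ℝ) :
    ns (φ t (sE i k) *ᵥ v) ≤ ns v := by
  rw [sE, map_smul, map_add, Matrix.smul_mulVec, Matrix.add_mulVec]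
  refine (ns_half _ _).trans ?_
  have h1 := El_contr φ hT t i k v
  have h2 := El_contr φ hT t k i v
  linarith

theorem sum_sE (hT : ∀ t M, φ t Mᵀ = (φ t M)ᵀ) (t : T) (v : N → ℝ) :
    ∑ i, ∑ k, ns (φ t (sE i k) *ᵥ v) ≤ (n + 1) * ns v := by
  have := sumY (T := Unit) (fun _ => φ t) (fun t s h => absurd (Subsingleton.elim t s) h)
    (fun _ => hT t) (fun _ => v)
  simpa using this

/-- psd-type transfer -/
theorem form_le (hT : ∀ t M, φ t Mᵀ = (φ t M)ᵀ) (t : T) (W : Matrix (Fin n) (Fin n) ℝ) (hW : Wᵀ = W)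
    (w : ℝ) (h : ∀ v : Fin n → ℝ, v ⬝ᵥ (W *ᵥ v) ≤ w * ns v) (v : N → ℝ) :
    v ⬝ᵥ (φ t W *ᵥ v) ≤ w * ns v := by
  obtain ⟨U, d, hU1, hU2, rfl⟩ := spec W hW
  have hd : ∀ i, d i ≤ w := by
    intro i
    have := h (fun j => U j i)
    rw [col_eig U d hU1, ns, unit_col U hU1] at this
    linarith
  set x := φ t Uᵀ *ᵥ v
  have e1 : v ⬝ᵥ (φ t (U * diagonal d * Uᵀ) *ᵥ v) = ∑ i, d i * ns (φ t (El i i) *ᵥ x) := by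
    have : U * diagonal d * Uᵀ = ∑ i, d i • ((El i i * Uᵀ)ᵀ * (El i i * Uᵀ)) := by
      have hd : diagonal d = ∑ i, d i • El i i := by
        ext a b
        rw [Matrix.sum_apply]
        simp only [El, Matrix.smul_apply, single_apply, diagonal_apply]
        by_cases hab : a = b
        · subst hab; simp
        · rw [if_neg hab]; symm
          refine Finset.sum_eq_zero fun i _ => ?_
          rw [if_neg]; · simp
          rintro ⟨h1, h2⟩; exact hab (h1.symm.trans h2)
      rw [hd, Finset.mul_sum, Finset.sum_mul]
      refine Finset.sum_congr rfl fun i _ => ?_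
      rw [transpose_mul, transpose_transpose, mul_smul_comm, smul_mul_assoc]
      congr 1
      calc U * El i i * Uᵀ = U * (El i i * El i i) * Uᵀ := by simp [El]
        _ = _ := by
          rw [show (El i i)ᵀ = El i i by simp [El]]
          simp only [Matrix.mul_assoc]
    rw [this, map_sum, Matrix.sum_mulVec, dotProduct_sum]
    refine Finset.sum_congr rfl fun i _ => ?_
    rw [map_smul, Matrix.smul_mulVec, dotProduct_smul, smul_eq_mul, map_mul, hT, ← ns_mulVec,
      map_mul, ← Matrix.mulVec_mulVec]
  have e2 : ns v = ∑ i, ns (φ t (El i i) *ᵥ x) := by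
    have : ns v = ns x := by
      rw [ns_mulVec, ← hT, ← map_mul, transpose_transpose, hU2, map_one, Matrix.one_mulVec]; rfl
    rw [this]
    have : ∀ i, ns (φ t (El i i) *ᵥ x) = x ⬝ᵥ (φ t (El i i) *ᵥ x) := by
      intro i
      rw [ns_mulVec, ← hT, ← map_mul]
      simp [El]
    simp only [this]
    rw [← dotProduct_sum, ← Matrix.sum_mulVec, ← map_sum, sum_El, map_one, Matrix.one_mulVec]
    rfl
  rw [e1, e2, Finset.mul_sum]
  exact Finset.sum_le_sum fun i _ => mul_le_mul_of_nonneg_right (hd i) (ns_nonneg _)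

end phi
end S18

namespace S18
open Matrix

section struct
variable {n : ℕ}

/-- triples -/
abbrev Tr (n : ℕ) := Fin 3 → Fin n

/-- triples as products -/
def trEquiv (n : ℕ) : Tr n ≃ Fin n × Fin n × Fin n where
  toFun a := (a 0, a 1, a 2)
  invFun p := ![p.1, p.2.1, p.2.2]
  left_inv a := by ext i; fin_cases i <;> rfl
  right_inv p := rfl

theorem sum3 {M : Type*} [AddCommMonoid M] (g : Fin n → Fin n → Fin n → M) :
    ∑ a : Tr n, g (a 0) (a 1) (a 2) = ∑ l, ∑ i, ∑ k, g l i k := by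
  refine (Fintype.sum_equiv (trEquiv n) (fun a => g (a 0) (a 1) (a 2))
    (fun p => g p.1 p.2.1 p.2.2) (fun _ => rfl)).trans ?_
  rw [Fintype.sum_prod_type]
  simp only [Fintype.sum_prod_type]

/-- symmetrized elementary matrix of a triple -/
noncomputable def sm (a : Tr n) : Matrix (Fin n) (Fin n) ℝ := sE (a 1) (a 2)

/-- symmetrized slices -/
noncomputable def Al (A : Tr n → Bool) (l : Fin n) : Matrix (Fin n) (Fin n) ℝ :=
  ∑ b, if b 0 = l then sg A b • sm b else 0

theorem Al_symm (A : Tr n → Bool) (l : Fin n) : (Al A l)ᵀ = Al A l := by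
  unfold Al
  rw [transpose_sum]
  refine Finset.sum_congr rfl fun b _ => ?_
  split_ifs
  · rw [transpose_smul, sm, sE_symm]
  · simp

theorem Al_eq (A : Tr n → Bool) (l : Fin n) :
    Al A l = ∑ i, ∑ k, sg A ![l, i, k] • sE i k := by
  have : ∀ b : Tr n, (if b 0 = l then sg A b • sm b else 0)
      = (fun x i k => if x = l then sg A ![x, i, k] • sE i k else 0) (b 0) (b 1) (b 2) := by
    intro b
    have hb : ![b 0, b 1, b 2] = b := by ext i; fin_cases i <;> rfl
    simp only [hb]
    rfl
  unfold Al
  rw [Finset.sum_congr rfl fun b _ => this b,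
    sum3 (fun x i k => if x = l then sg A ![x, i, k] • sE i k else 0)]
  rw [Finset.sum_eq_single l]
  · simp
  · intro b _ hb; simp [hb]
  · simp

theorem Al_apply (A : Tr n → Bool) (l i k : Fin n) :
    Al A l i k = (sg A ![l, i, k] + sg A ![l, k, i]) / 2 := by
  rw [Al_eq]
  simp only [Matrix.sum_apply, sE, El, Matrix.smul_apply, Matrix.add_apply, single_apply, smul_eq_mul]
  have : ∀ x y : Fin n, sg A ![l, x, y] * (1 / 2 * ((if x = i ∧ y = k then (1:ℝ) else 0) + if y = i ∧ x = k then 1 else 0))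
     = (if x = i then (if y = k then sg A ![l, x, y] / 2 else 0) else 0)
       + (if x = k then (if y = i then sg A ![l, x, y] / 2 else 0) else 0) := by
    intro x y
    rw [ite_and, ite_and]
    split_ifs <;> ring
  simp only [this, Finset.sum_add_distrib]
  simp
  ring

theorem abs_sg {κ : Type*} (A : κ → Bool) (a : κ) : |sg A a| = 1 := by
  unfold sg; split_ifs <;> norm_num

theorem Al_le (A : Tr n → Bool) (l i k : Fin n) : (Al A l i k) ^ 2 ≤ 1 := by
  rw [Al_apply, sq_le_one_iff_abs_le_one, abs_div]
  have := abs_add_le (sg A ![l, i, k]) (sg A ![l, k, i])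
  rw [abs_sg, abs_sg] at this
  rw [abs_of_pos (by norm_num : (0:ℝ) < 2)]
  linarith

variable {N : Type*} [Fintype N] [DecidableEq N]
variable (B : Matrix (Fin n) (Fin n) ℝ →ₗ[ℝ] Matrix (Fin n) (Fin n) ℝ →ₗ[ℝ] Matrix N N ℝ)

/-- chaos coefficients -/
noncomputable def XB (a b : Tr n) : Matrix N N ℝ :=
  if a ≠ b ∧ a 0 = b 0 then B (sm a) (sm b) else 0

theorem XB_self (a : Tr n) : XB B a a = 0 := by simp [XB]

theorem XB_comm (hB : ∀ M P, B M P = B P M) (a b : Tr n) : XB B a b = XB B b a := by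
  unfold XB
  simp only [ne_comm (a := a), eq_comm (a := a 0), hB (sm a)]

theorem XB_symm (hB : ∀ M P, Mᵀ = M → Pᵀ = P → (B M P)ᵀ = B M P) (a b : Tr n) :
    (XB B a b)ᵀ = XB B a b := by
  unfold XB
  split_ifs
  · exact hB _ _ (sE_symm _ _) (sE_symm _ _)
  · simp

theorem Lc_XB (A : Tr n → Bool) (a : Tr n) :
    Lc (XB B) A a = B (sm a) (Al A (a 0)) - sg A a • B (sm a) (sm a) := by
  unfold Lc Al
  rw [map_sum]
  have : ∀ b, sg A b • XB B a b = B (sm a) (if b 0 = a 0 then sg A b • sm b else 0)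
      - (if b = a then sg A a • B (sm a) (sm a) else 0) := by
    intro b
    unfold XB
    by_cases h : b = a
    · subst h; simp
    · by_cases h2 : b 0 = a 0
      · simp [h, h2, ne_comm.1 h]
      · simp [h, h2, eq_comm (a := a 0)]
  rw [Finset.sum_congr rfl fun b _ => this b, Finset.sum_sub_distrib]
  simp

theorem Hc_XB (A : Tr n → Bool) :
    Hc (XB B) A = ∑ l, B (Al A l) (Al A l) - ∑ a, B (sm a) (sm a) := by
  unfold Hc
  simp only [Lc_XB, smul_sub, smul_smul, sg_mul_self, one_smul, Finset.sum_sub_distrib]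
  congr 1
  have : ∀ l, B (Al A l) (Al A l) = ∑ a, if a 0 = l then sg A a • B (sm a) (Al A l) else 0 := by
    intro l
    conv_lhs => rw [show B (Al A l) = B (∑ b, if b 0 = l then sg A b • sm b else 0) from rfl]
    rw [map_sum, LinearMap.sum_apply]
    refine Finset.sum_congr rfl fun a _ => ?_
    split_ifs <;> simp
  simp only [this]
  rw [Finset.sum_comm]
  simp

end struct

section one
variable {n : ℕ}

/-- the anticommutator -/
noncomputable def B1 (n : ℕ) : Matrix (Fin n) (Fin n) ℝ →ₗ[ℝ] Matrix (Fin n) (Fin n) ℝ →ₗ[ℝ]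
    Matrix (Fin n) (Fin n) ℝ :=
  LinearMap.mk₂ ℝ (fun M P => (1 / 2 : ℝ) • (M * P + P * M))
    (by intros; simp only [add_mul, mul_add]; module)
    (by intros; simp only [smul_mul_assoc, mul_smul_comm]; module)
    (by intros; simp only [add_mul, mul_add]; module)
    (by intros; simp only [smul_mul_assoc, mul_smul_comm]; module)

theorem B1_apply (M P : Matrix (Fin n) (Fin n) ℝ) : B1 n M P = (1 / 2 : ℝ) • (M * P + P * M) := rfl

theorem B1_self (M : Matrix (Fin n) (Fin n) ℝ) : B1 n M M = M * M := by
  rw [B1_apply]; module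

/-- one-particle chaos -/
noncomputable def H1 (A : Tr n → Bool) : Matrix (Fin n) (Fin n) ℝ := Hc (XB (B1 n)) A

theorem B1_comm (M P : Matrix (Fin n) (Fin n) ℝ) : B1 n M P = B1 n P M := by
  rw [B1_apply, B1_apply, add_comm]

theorem B1_symm (M P : Matrix (Fin n) (Fin n) ℝ) (hM : Mᵀ = M) (hP : Pᵀ = P) :
    (B1 n M P)ᵀ = B1 n M P := by
  rw [B1_apply, transpose_smul, transpose_add, transpose_mul, transpose_mul, hM, hP, add_comm]

theorem H1_symm (A : Tr n → Bool) : (H1 A)ᵀ = H1 A :=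
  Hc_symm _ (XB_symm _ B1_symm) A

theorem H1_eq (A : Tr n → Bool) : H1 A = ∑ l, Al A l * Al A l - ∑ a, sm a * sm a := by
  rw [H1, Hc_XB]; simp only [B1_self]

theorem sum_sm_ns (v : Fin n → ℝ) : ∑ a : Tr n, ns (sm a *ᵥ v) ≤ n * (n + 1) * ns v := by
  have h := sum_sE (T := Unit) (N := Fin n) (fun _ => AlgHom.id ℝ (Matrix (Fin n) (Fin n) ℝ)) (fun _ _ => rfl) () v
  simp only [AlgHom.id_apply] at h
  unfold sm
  rw [sum3 (fun _ i k => ns (sE i k *ᵥ v))]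
  simp only [Finset.sum_const, Finset.card_univ, Fintype.card_fin, nsmul_eq_mul]
  rw [mul_assoc]
  gcongr

/-- W form in terms of H1 -/
theorem W_form (A : Tr n → Bool) (v : Fin n → ℝ) :
    ∑ l, ns (Al A l *ᵥ v) = v ⬝ᵥ (H1 A *ᵥ v) + ∑ a : Tr n, ns (sm a *ᵥ v) := by
  rw [H1_eq, Matrix.sub_mulVec, dotProduct_sub, Matrix.sum_mulVec, Matrix.sum_mulVec, dotProduct_sum,
    dotProduct_sum]
  simp only [ns_mulVec_symm _ (Al_symm A _)]
  have : ∀ a : Tr n, ns (sm a *ᵥ v) = v ⬝ᵥ ((sm a * sm a) *ᵥ v) :=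
    fun a => ns_mulVec_symm _ (sE_symm _ _) v
  simp only [this]
  ring

theorem El_mulVec (i k : Fin n) (v : Fin n → ℝ) (M : Matrix (Fin n) (Fin n) ℝ) :
    ns (M *ᵥ (El i k *ᵥ v)) = v k ^ 2 * ∑ j, M j i ^ 2 := by
  have : El i k *ᵥ v = v k • Pi.single i 1 := by
    ext j
    by_cases h : j = i
    · subst h; simp [El, mulVec, dotProduct, single_apply]
    · simp [El, mulVec, dotProduct, single_apply, h, Ne.symm h]
  rw [this, Matrix.mulVec_smul, ns_smul, ns_eq]
  simp

theorem sum_M_sE (M : Matrix (Fin n) (Fin n) ℝ) (hM : ∀ i j, M i j ^ 2 ≤ 1) (v : Fin n → ℝ) :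
    ∑ i, ∑ k, ns (M *ᵥ (sE i k *ᵥ v)) ≤ n ^ 2 * ns v := by
  have h1 : ∀ i k, ns (M *ᵥ (sE i k *ᵥ v))
      ≤ (ns (M *ᵥ (El i k *ᵥ v)) + ns (M *ᵥ (El k i *ᵥ v))) / 2 := by
    intro i k
    rw [sE, Matrix.smul_mulVec, Matrix.add_mulVec, Matrix.mulVec_smul, Matrix.mulVec_add]
    exact ns_half _ _
  have h2 : ∑ i, ∑ k, ns (M *ᵥ (El i k *ᵥ v)) ≤ n ^ 2 * ns v := by
    simp only [El_mulVec]
    have : ∀ i, ∑ j, M j i ^ 2 ≤ n := by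
      intro i
      refine (Finset.sum_le_sum fun j _ => hM j i).trans ?_
      simp
    calc ∑ i, ∑ k, v k ^ 2 * ∑ j, M j i ^ 2 ≤ ∑ i : Fin n, ∑ k, v k ^ 2 * n := by
          gcongr with i _ k _; exact this i
      _ = n ^ 2 * ns v := by
          rw [ns_eq, ← Finset.sum_mul]; simp; ring
  refine (Finset.sum_le_sum fun i _ => Finset.sum_le_sum fun k _ => h1 i k).trans ?_
  simp only [← Finset.sum_div, Finset.sum_add_distrib]
  rw [Finset.sum_comm (f := fun i k => ns (M *ᵥ (El k i *ᵥ v)))]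
  linarith

theorem one_V (hn : 1 ≤ n) (A : Tr n → Bool) (v : Fin n → ℝ) :
    ∑ a, ns (Lc (XB (B1 n)) A a *ᵥ v) ≤ 10 * n ^ 3 * ns v + (n + 1) * (v ⬝ᵥ (H1 A *ᵥ v)) := by
  have hφ : ∀ (_ : Unit) (M : Matrix (Fin n) (Fin n) ℝ), AlgHom.id ℝ _ Mᵀ = (AlgHom.id ℝ _ M)ᵀ :=
    fun _ _ => rfl
  have h1 : ∀ a : Tr n, ns (Lc (XB (B1 n)) A a *ᵥ v)
      ≤ ns (sm a *ᵥ (Al A (a 0) *ᵥ v)) + ns (Al A (a 0) *ᵥ (sm a *ᵥ v)) + 2 * ns (sm a *ᵥ v) := by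
    intro a
    rw [Lc_XB, Matrix.sub_mulVec, Matrix.smul_mulVec, B1_self, B1_apply, Matrix.smul_mulVec,
      Matrix.add_mulVec, ← Matrix.mulVec_mulVec, ← Matrix.mulVec_mulVec, ← Matrix.mulVec_mulVec]
    have e1 := ns_sub_le ((1 / 2 : ℝ) • (sm a *ᵥ (Al A (a 0) *ᵥ v) + Al A (a 0) *ᵥ (sm a *ᵥ v)))
      (sg A a • sm a *ᵥ (sm a *ᵥ v))
    have e2 := ns_half (sm a *ᵥ (Al A (a 0) *ᵥ v)) (Al A (a 0) *ᵥ (sm a *ᵥ v))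
    have e3 : ns (sg A a • sm a *ᵥ (sm a *ᵥ v)) ≤ ns (sm a *ᵥ v) := by
      rw [ns_smul, sq, sg_mul_self, one_mul]
      exact sE_contr (T := Unit) (fun _ => AlgHom.id ℝ _) hφ () _ _ _
    linarith
  have h2 : ∑ a : Tr n, ns (sm a *ᵥ (Al A (a 0) *ᵥ v)) ≤ (n + 1) * ∑ l, ns (Al A l *ᵥ v) := by
    unfold sm
    rw [sum3 (fun l i k => ns (sE i k *ᵥ (Al A l *ᵥ v))), Finset.mul_sum]
    exact Finset.sum_le_sum fun l _ => sum_sE (T := Unit) (fun _ => AlgHom.id ℝ _) hφ () _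
  have h3 : ∑ a : Tr n, ns (Al A (a 0) *ᵥ (sm a *ᵥ v)) ≤ n * (n ^ 2 * ns v) := by
    unfold sm
    rw [sum3 (fun l i k => ns (Al A l *ᵥ (sE i k *ᵥ v)))]
    refine (Finset.sum_le_sum fun l _ => sum_M_sE (Al A l) (Al_le A l) v).trans ?_
    simp
  have h4 := sum_sm_ns v
  rw [W_form] at h2
  refine (Finset.sum_le_sum fun a _ => h1 a).trans ?_
  rw [Finset.sum_add_distrib, Finset.sum_add_distrib, ← Finset.mul_sum]
  have hn' : (1 : ℝ) ≤ n := by exact_mod_cast hn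
  have hv := ns_nonneg v
  have h5 : (n + 1 : ℝ) * ∑ a : Tr n, ns (sm a *ᵥ v) ≤ (n + 1) * (n * (n + 1) * ns v) := by gcongr
  have h6 : ((n : ℝ) + 1) * (n * (n + 1)) + n * n ^ 2 + 2 * (n * (n + 1)) ≤ 10 * n ^ 3 := by
    nlinarith [mul_nonneg (sub_nonneg.2 hn') (sub_nonneg.2 hn'), mul_nonneg (mul_nonneg (sub_nonneg.2 hn') (sub_nonneg.2 hn')) (sub_nonneg.2 hn')]
  nlinarith [mul_le_mul_of_nonneg_right h6 hv]

theorem one_moment (hn : 1 ≤ n) (p : ℕ) (hp : 1 ≤ p) (hpn : 2 * p ≤ n) :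
    ∑ A : Tr n → Bool, trace (H1 A ^ (2 * p))
      ≤ Fintype.card (Tr n → Bool) * (4 * n * (16 * (n : ℝ) ^ 2) ^ (2 * p)) := by
  have h := closing (XB (B1 n)) (XB_self _) (XB_comm _ B1_comm) (XB_symm _ B1_symm)
    (fun _ => 10 * (n : ℝ) ^ 3) (n + 1) (fun _ => by positivity) (by positivity)
    (fun A v => one_V hn A v) p hp
  refine h.trans ?_
  rw [Finset.sum_const, Finset.card_univ, nsmul_eq_mul, Fintype.card_fin]
  have hn' : (1 : ℝ) ≤ n := by exact_mod_cast hn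
  have hpn' : 2 * (p : ℝ) ≤ n := by exact_mod_cast hpn
  have e1 : (16 * (p : ℝ) * (10 * n ^ 3)) ^ p ≤ (16 * (n : ℝ) ^ 2) ^ (2 * p) := by
    rw [pow_mul (16 * (n : ℝ) ^ 2)]
    gcongr
    have : (p : ℝ) * n ^ 3 ≤ n / 2 * n ^ 3 := by gcongr; linarith
    nlinarith [pow_nonneg (zero_le_one.trans hn') 4]
  have e2 : (16 * (p : ℝ) * (n + 1)) ^ (2 * p) ≤ (16 * (n : ℝ) ^ 2) ^ (2 * p) := by
    refine pow_le_pow_left₀ (by positivity) ?_ _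
    have : (p : ℝ) * (n + 1) ≤ n / 2 * (n + n) := by gcongr; linarith
    nlinarith
  have : (0 : ℝ) ≤ Fintype.card (Tr n → Bool) := Nat.cast_nonneg _
  calc _ ≤ 2 * (n : ℝ) * (Fintype.card (Tr n → Bool) * ((16 * (n : ℝ) ^ 2) ^ (2 * p)
        + (16 * (n : ℝ) ^ 2) ^ (2 * p))) := by gcongr
    _ = _ := by ring
end one
end S18

namespace S18
open Matrix

section many
variable {N : Type*} [Fintype N] [DecidableEq N] {n : ℕ}
variable {T : Type*} [Fintype T] [DecidableEq T]
variable (φ : T → (Matrix (Fin n) (Fin n) ℝ →ₐ[ℝ] Matrix N N ℝ))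

/-- second quantization -/
noncomputable def SS (M : Matrix (Fin n) (Fin n) ℝ) : Matrix N N ℝ := ∑ t, φ t M

/-- pair operator -/
noncomputable def BM : Matrix (Fin n) (Fin n) ℝ →ₗ[ℝ] Matrix (Fin n) (Fin n) ℝ →ₗ[ℝ] Matrix N N ℝ :=
  LinearMap.mk₂ ℝ (fun M P => SS φ M * SS φ P - SS φ (M * P))
    (by intros; simp only [SS, map_add, Finset.sum_add_distrib, add_mul]; abel)
    (by intros; simp only [SS, map_smul, ← Finset.smul_sum, smul_mul_assoc, smul_sub])
    (by intros; simp only [SS, map_add, Finset.sum_add_distrib, mul_add]; abel)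
    (by intros; simp only [SS, map_smul, ← Finset.smul_sum, mul_smul_comm, smul_sub])

theorem BM_apply (M P : Matrix (Fin n) (Fin n) ℝ) :
    BM φ M P = SS φ M * SS φ P - SS φ (M * P) := rfl

theorem BM_eq (M P : Matrix (Fin n) (Fin n) ℝ) :
    BM φ M P = ∑ t, ∑ s, if s = t then 0 else φ t M * φ s P := by
  have : ∀ t s, (if s = t then 0 else φ t M * φ s P)
      = φ t M * φ s P - if s = t then φ t M * φ s P else 0 := by
    intro t s; split_ifs <;> simp
  simp only [this, Finset.sum_sub_distrib]
  rw [BM_apply]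
  simp only [SS, Finset.sum_mul, Finset.mul_sum, map_mul, Finset.sum_ite_eq', Finset.mem_univ, if_true]
  rw [Finset.sum_comm]

theorem BM_comm (hc : ∀ t s, t ≠ s → ∀ M P, φ t M * φ s P = φ s P * φ t M)
    (M P : Matrix (Fin n) (Fin n) ℝ) : BM φ M P = BM φ P M := by
  rw [BM_eq, BM_eq, Finset.sum_comm]
  refine Finset.sum_congr rfl fun t _ => Finset.sum_congr rfl fun s _ => ?_
  by_cases h : t = s
  · simp [h]
  · rw [if_neg h, if_neg (Ne.symm h), hc _ _ (Ne.symm h)]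

theorem BM_symm (hc : ∀ t s, t ≠ s → ∀ M P, φ t M * φ s P = φ s P * φ t M)
    (hT : ∀ t M, φ t Mᵀ = (φ t M)ᵀ)
    (M P : Matrix (Fin n) (Fin n) ℝ) (hM : Mᵀ = M) (hP : Pᵀ = P) : (BM φ M P)ᵀ = BM φ M P := by
  rw [BM_eq, transpose_sum]
  refine Finset.sum_congr rfl fun t _ => ?_
  rw [transpose_sum]
  refine Finset.sum_congr rfl fun s _ => ?_
  by_cases h : s = t
  · simp [h]
  · rw [if_neg h, transpose_mul, ← hT, ← hT, hM, hP, hc _ _ h]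

theorem BM_mulVec (M P : Matrix (Fin n) (Fin n) ℝ) (v : N → ℝ) :
    BM φ M P *ᵥ v = ∑ t, φ t M *ᵥ (SS φ P *ᵥ v - φ t P *ᵥ v) := by
  rw [BM_apply, Matrix.sub_mulVec]
  simp only [Matrix.mulVec_sub, Finset.sum_sub_distrib, Matrix.mulVec_mulVec, ← map_mul]
  rw [← Matrix.sum_mulVec, ← Matrix.sum_mulVec, ← Finset.sum_mul]
  rfl

theorem SS_symm (hT : ∀ t M, φ t Mᵀ = (φ t M)ᵀ) (M : Matrix (Fin n) (Fin n) ℝ) (hM : Mᵀ = M) :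
    (SS φ M)ᵀ = SS φ M := by
  rw [SS, transpose_sum]
  simp only [← hT, hM]

theorem phi_symm (hT : ∀ t M, φ t Mᵀ = (φ t M)ᵀ) (M : Matrix (Fin n) (Fin n) ℝ) (hM : Mᵀ = M) (t : T) :
    (φ t M)ᵀ = φ t M := by
  rw [← hT, hM]

theorem ns_SS (hT : ∀ t M, φ t Mᵀ = (φ t M)ᵀ) (M : Matrix (Fin n) (Fin n) ℝ) (hM : Mᵀ = M)
    (v : N → ℝ) :
    ns (SS φ M *ᵥ v) = v ⬝ᵥ (BM φ M M *ᵥ v) + ∑ t, ns (φ t M *ᵥ v) := by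
  rw [ns_mulVec_symm _ (SS_symm φ hT M hM), BM_apply, Matrix.sub_mulVec, dotProduct_sub]
  simp only [ns_mulVec_symm _ (phi_symm φ hT M hM _), ← map_mul]
  conv_lhs => rw [← sub_add_cancel (v ⬝ᵥ ((SS φ M * SS φ M) *ᵥ v)) (v ⬝ᵥ (SS φ (M * M) *ᵥ v))]
  congr 1
  rw [SS, Matrix.sum_mulVec, dotProduct_sum]

theorem sum_u (hT : ∀ t M, φ t Mᵀ = (φ t M)ᵀ) (M : Matrix (Fin n) (Fin n) ℝ) (hM : Mᵀ = M)
    (v : N → ℝ) :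
    ∑ t, ns (SS φ M *ᵥ v - φ t M *ᵥ v)
      = (Fintype.card T - 2) * (v ⬝ᵥ (BM φ M M *ᵥ v))
        + (Fintype.card T - 1) * ∑ t, ns (φ t M *ᵥ v) := by
  have h := ns_SS φ hT M hM v
  simp only [ns_sub, Finset.sum_add_distrib, Finset.sum_sub_distrib, ← Finset.mul_sum]
  rw [← dotProduct_sum, ← Matrix.sum_mulVec]
  change _ - 2 * ((SS φ M *ᵥ v) ⬝ᵥ (SS φ M *ᵥ v)) + _ = _
  rw [show (SS φ M *ᵥ v) ⬝ᵥ (SS φ M *ᵥ v) = ns (SS φ M *ᵥ v) from rfl]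
  simp only [Finset.sum_const, Finset.card_univ, nsmul_eq_mul, h]
  ring

theorem ns_Q (hT : ∀ t M, φ t Mᵀ = (φ t M)ᵀ) (i k : Fin n) (v : N → ℝ) :
    ns (BM φ (sE i k) (sE i k) *ᵥ v)
      ≤ 2 * (Fintype.card T : ℝ) ^ 2 * ns (SS φ (sE i k) *ᵥ v)
        + 2 * Fintype.card T * ∑ t, ns (φ t (sE i k) *ᵥ v) := by
  rw [BM_mulVec]
  refine (ns_sum_le _).trans ?_
  have : ∑ t, ns (φ t (sE i k) *ᵥ (SS φ (sE i k) *ᵥ v - φ t (sE i k) *ᵥ v))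
      ≤ ∑ t, (2 * ns (SS φ (sE i k) *ᵥ v) + 2 * ns (φ t (sE i k) *ᵥ v)) :=
    Finset.sum_le_sum fun t _ => (sE_contr φ hT t i k _).trans (ns_sub_le _ _)
  rw [Finset.sum_add_distrib, ← Finset.mul_sum, ← Finset.mul_sum, Finset.sum_const, Finset.card_univ, nsmul_eq_mul] at this
  refine (mul_le_mul_of_nonneg_left this (Nat.cast_nonneg _)).trans (le_of_eq ?_)
  ring

theorem sum_SS_sm (hc : ∀ t s, t ≠ s → ∀ M P, φ t M * φ s P = φ s P * φ t M)
    (hT : ∀ t M, φ t Mᵀ = (φ t M)ᵀ) (v : N → ℝ) :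
    ∑ a : Tr n, ns (SS φ (sm a) *ᵥ v) ≤ n * ((n + Fintype.card T) * (Fintype.card T * ns v)) := by
  have h := sumY φ hc hT (fun _ => v)
  unfold sm
  rw [sum3 (fun _ i k => ns (SS φ (sE i k) *ᵥ v))]
  simp only [Finset.sum_const, Finset.card_univ, Fintype.card_fin, nsmul_eq_mul] at h ⊢
  simp only [SS, Matrix.sum_mulVec]
  gcongr

theorem sum_phi_sm (hT : ∀ t M, φ t Mᵀ = (φ t M)ᵀ) (v : N → ℝ) :
    ∑ a : Tr n, ∑ t, ns (φ t (sm a) *ᵥ v) ≤ Fintype.card T * (n * ((n + 1) * ns v)) := by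
  rw [Finset.sum_comm]
  have : ∀ t, ∑ a : Tr n, ns (φ t (sm a) *ᵥ v) ≤ n * ((n + 1) * ns v) := by
    intro t
    unfold sm
    rw [sum3 (fun _ i k => ns (φ t (sE i k) *ᵥ v))]
    simp only [Finset.sum_const, Finset.card_univ, Fintype.card_fin, nsmul_eq_mul]
    have := sum_sE φ hT t v
    gcongr
  refine (Finset.sum_le_sum fun t _ => this t).trans ?_
  simp

theorem sum_phi_Al (hT : ∀ t M, φ t Mᵀ = (φ t M)ᵀ) (A : Tr n → Bool) (w : ℝ)
    (hw : ∀ x : Fin n → ℝ, x ⬝ᵥ (H1 A *ᵥ x) ≤ w * ns x) (v : N → ℝ) (t : T) :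
    ∑ l, ns (φ t (Al A l) *ᵥ v) ≤ (w + n * (n + 1)) * ns v := by
  have h1 : ∑ l, ns (φ t (Al A l) *ᵥ v) = v ⬝ᵥ (φ t (∑ l, Al A l * Al A l) *ᵥ v) := by
    rw [map_sum, Matrix.sum_mulVec, dotProduct_sum]
    refine Finset.sum_congr rfl fun l _ => ?_
    rw [ns_mulVec_symm _ (phi_symm φ hT _ (Al_symm A l) t), map_mul]
  rw [h1]
  refine form_le φ hT t _ ?_ _ ?_ v
  · rw [transpose_sum]
    simp only [transpose_mul, Al_symm]
  · intro x
    have := W_form A x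
    rw [Matrix.sum_mulVec, dotProduct_sum]
    simp only [ns_mulVec_symm _ (Al_symm A _)] at this
    rw [this]
    have h2 := hw x
    have h3 := sum_sm_ns x
    rw [add_mul]
    linarith

/-- many-particle chaos -/
noncomputable def HM (A : Tr n → Bool) : Matrix N N ℝ := Hc (XB (BM φ)) A

theorem HM_symm (hc : ∀ t s, t ≠ s → ∀ M P, φ t M * φ s P = φ s P * φ t M)
    (hT : ∀ t M, φ t Mᵀ = (φ t M)ᵀ) (A : Tr n → Bool) : (HM φ A)ᵀ = HM φ A :=
  Hc_symm _ (XB_symm _ (BM_symm φ hc hT)) A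

theorem many_V (hc : ∀ t s, t ≠ s → ∀ M P, φ t M * φ s P = φ s P * φ t M)
    (hT : ∀ t M, φ t Mᵀ = (φ t M)ᵀ) (hm : 2 ≤ Fintype.card T) (hmn : Fintype.card T ≤ n)
    (A : Tr n → Bool) (w : ℝ) (hw0 : 0 ≤ w)
    (hw : ∀ x : Fin n → ℝ, x ⬝ᵥ (H1 A *ᵥ x) ≤ w * ns x) (v : N → ℝ) :
    ∑ a, ns (Lc (XB (BM φ)) A a *ᵥ v)
      ≤ (32 * n ^ 3 * (Fintype.card T : ℝ) ^ 2 + 4 * n * (Fintype.card T : ℝ) ^ 2 * w) * ns v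
        + (2 * (n + Fintype.card T) * (Fintype.card T - 2)) * (v ⬝ᵥ (HM φ A *ᵥ v)) := by
  have e0 : ∀ a : Tr n, ns (Lc (XB (BM φ)) A a *ᵥ v)
      ≤ 2 * ns (∑ t, φ t (sm a) *ᵥ (SS φ (Al A (a 0)) *ᵥ v - φ t (Al A (a 0)) *ᵥ v))
        + 2 * (2 * (Fintype.card T : ℝ) ^ 2 * ns (SS φ (sm a) *ᵥ v)
        + 2 * Fintype.card T * ∑ t, ns (φ t (sm a) *ᵥ v)) := by
    intro a
    rw [Lc_XB, Matrix.sub_mulVec, Matrix.smul_mulVec, BM_mulVec φ _ (Al A (a 0))]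
    refine (ns_sub_le _ _).trans ?_
    have := ns_Q φ hT (a 1) (a 2) v
    rw [ns_smul, sq, sg_mul_self, one_mul]
    exact add_le_add le_rfl (mul_le_mul_of_nonneg_left this (by norm_num))
  have e1 : ∑ a : Tr n, ns (∑ t, φ t (sm a) *ᵥ (SS φ (Al A (a 0)) *ᵥ v - φ t (Al A (a 0)) *ᵥ v))
      ≤ (n + Fintype.card T) * ∑ l, ∑ t, ns (SS φ (Al A l) *ᵥ v - φ t (Al A l) *ᵥ v) := by
    unfold sm
    rw [sum3 (fun l i k => ns (∑ t, φ t (sE i k) *ᵥ (SS φ (Al A l) *ᵥ v - φ t (Al A l) *ᵥ v))),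
      Finset.mul_sum]
    exact Finset.sum_le_sum fun l _ => sumY φ hc hT (fun t => SS φ (Al A l) *ᵥ v - φ t (Al A l) *ᵥ v)
  have e2 := sum_SS_sm φ hc hT v
  have e3 := sum_phi_sm φ hT v
  have e4 : ∑ t, ∑ l, ns (φ t (Al A l) *ᵥ v) ≤ Fintype.card T * ((w + n * (n + 1)) * ns v) := by
    refine (Finset.sum_le_sum fun t _ => sum_phi_Al φ hT A w hw v t).trans ?_
    simp
  have e5 : ∑ l, v ⬝ᵥ (BM φ (Al A l) (Al A l) *ᵥ v)
      ≤ v ⬝ᵥ (HM φ A *ᵥ v) + ∑ a : Tr n, ns (SS φ (sm a) *ᵥ v) := by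
    rw [HM, Hc_XB, Matrix.sub_mulVec, dotProduct_sub, Matrix.sum_mulVec, Matrix.sum_mulVec,
      dotProduct_sum, dotProduct_sum]
    have : ∑ a : Tr n, v ⬝ᵥ (BM φ (sm a) (sm a) *ᵥ v) ≤ ∑ a : Tr n, ns (SS φ (sm a) *ᵥ v) := by
      refine Finset.sum_le_sum fun a _ => ?_
      rw [ns_SS φ hT (sm a) (sE_symm _ _)]
      have : 0 ≤ ∑ t, ns (φ t (sm a) *ᵥ v) := Finset.sum_nonneg fun t _ => ns_nonneg _
      linarith
    linarith
  have e6 : ∑ l, ∑ t, ns (SS φ (Al A l) *ᵥ v - φ t (Al A l) *ᵥ v)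
      = (Fintype.card T - 2) * ∑ l, v ⬝ᵥ (BM φ (Al A l) (Al A l) *ᵥ v)
        + (Fintype.card T - 1) * ∑ t, ∑ l, ns (φ t (Al A l) *ᵥ v) := by
    rw [Finset.sum_comm (f := fun t l => ns (φ t (Al A l) *ᵥ v)), Finset.mul_sum, Finset.mul_sum,
      ← Finset.sum_add_distrib]
    exact Finset.sum_congr rfl fun l _ => sum_u φ hT _ (Al_symm A l) v
  have hs := Finset.sum_le_sum fun (a : Tr n) (_ : a ∈ Finset.univ) => e0 a
  simp only [Finset.sum_add_distrib, ← Finset.mul_sum] at hs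
  refine hs.trans ?_
  have hm' : (2 : ℝ) ≤ Fintype.card T := by exact_mod_cast hm
  have hmn' : (Fintype.card T : ℝ) ≤ n := by exact_mod_cast hmn
  generalize (Fintype.card T : ℝ) = m at *
  generalize (n : ℝ) = x at *
  generalize v ⬝ᵥ (HM φ A *ᵥ v) = h at *
  have hv := ns_nonneg v
  generalize ns v = y at *
  generalize (∑ l, ∑ t, ns (SS φ (Al A l) *ᵥ v - φ t (Al A l) *ᵥ v)) = U at *
  generalize (∑ l, v ⬝ᵥ (BM φ (Al A l) (Al A l) *ᵥ v)) = D at *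
  generalize (∑ t, ∑ l, ns (φ t (Al A l) *ᵥ v)) = G at *
  generalize (∑ a : Tr n, ns (SS φ (sm a) *ᵥ v)) = S at *
  generalize (∑ a : Tr n, ∑ t, ns (φ t (sm a) *ᵥ v)) = R at *
  generalize (∑ a : Tr n, ns (∑ t, φ t (sm a) *ᵥ (SS φ (Al A (a 0)) *ᵥ v - φ t (Al A (a 0)) *ᵥ v))) = Z at *
  have hm0 : 0 ≤ m - 2 := by linarith
  have hx : 2 ≤ x := by linarith
  have f2 : S ≤ 2 * x ^ 2 * m * y := by
    refine e2.trans ?_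
    calc x * ((x + m) * (m * y)) ≤ x * ((x + x) * (m * y)) := by gcongr
      _ = _ := by ring
  have f3 : R ≤ 2 * x ^ 2 * m * y := by
    refine e3.trans ?_
    calc m * (x * ((x + 1) * y)) ≤ m * (x * ((x + x) * y)) := by gcongr; linarith
      _ = _ := by ring
  have f4 : G ≤ (m * w + 2 * x ^ 2 * m) * y := by
    refine e4.trans ?_
    calc m * ((w + x * (x + 1)) * y) ≤ m * ((w + x * (x + x)) * y) := by gcongr; linarith
      _ = _ := by ring
  have f6 : U ≤ (m - 2) * h + m * (2 * x ^ 2 * m * y) + m * ((m * w + 2 * x ^ 2 * m) * y) := by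
    rw [e6]
    have g1 : (m - 2) * D ≤ (m - 2) * (h + 2 * x ^ 2 * m * y) := by gcongr; linarith
    have g2 : (m - 1) * G ≤ (m - 1) * ((m * w + 2 * x ^ 2 * m) * y) := by gcongr; linarith
    have g3 : 0 ≤ 2 * x ^ 2 * m * y := by positivity
    have g4 : 0 ≤ (m * w + 2 * x ^ 2 * m) * y := by positivity
    nlinarith
  have f7 : Z ≤ (x + m) * ((m - 2) * h) + (x + x) * (m * (2 * x ^ 2 * m * y) + m * ((m * w + 2 * x ^ 2 * m) * y)) := by
    refine e1.trans ?_
    have g3 : 0 ≤ m * (2 * x ^ 2 * m * y) + m * ((m * w + 2 * x ^ 2 * m) * y) := by positivity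
    calc (x + m) * U ≤ (x + m) * ((m - 2) * h + m * (2 * x ^ 2 * m * y) + m * ((m * w + 2 * x ^ 2 * m) * y)) := by gcongr
      _ = (x + m) * ((m - 2) * h) + (x + m) * (m * (2 * x ^ 2 * m * y) + m * ((m * w + 2 * x ^ 2 * m) * y)) := by ring
      _ ≤ _ := by gcongr
  have f8 : 2 * m ^ 2 * S ≤ 4 * x ^ 3 * m ^ 2 * y := by
    calc 2 * m ^ 2 * S ≤ 2 * m ^ 2 * (2 * x ^ 2 * m * y) := by gcongr
      _ = 4 * x ^ 2 * m ^ 2 * y * m := by ring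
      _ ≤ 4 * x ^ 2 * m ^ 2 * y * x := by gcongr
      _ = _ := by ring
  have f9 : 2 * m * R ≤ 4 * x ^ 3 * m ^ 2 * y := by
    calc 2 * m * R ≤ 2 * m * (2 * x ^ 2 * m * y) := by gcongr
      _ = 4 * x ^ 2 * m ^ 2 * y * 1 := by ring
      _ ≤ 4 * x ^ 2 * m ^ 2 * y * x := by gcongr; linarith
      _ = _ := by ring
  linarith

theorem rayleigh (U : Matrix N N ℝ) (d : N → ℝ) (h2 : U * Uᵀ = 1) (w : ℝ) (hd : ∀ i, d i ≤ w)
    (x : N → ℝ) : x ⬝ᵥ ((U * diagonal d * Uᵀ) *ᵥ x) ≤ w * ns x := by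
  have e1 : x ⬝ᵥ ((U * diagonal d * Uᵀ) *ᵥ x) = (Uᵀ *ᵥ x) ⬝ᵥ (diagonal d *ᵥ (Uᵀ *ᵥ x)) := by
    rw [← Matrix.mulVec_mulVec, ← Matrix.mulVec_mulVec, dotProduct_mulVec x, ← Matrix.mulVec_transpose]
  have e2 : ns x = ns (Uᵀ *ᵥ x) := by
    rw [ns_mulVec, transpose_transpose, h2, Matrix.one_mulVec]; rfl
  rw [e1, e2, ns_eq, Finset.mul_sum, dotProduct]
  refine Finset.sum_le_sum fun i _ => ?_
  rw [mulVec_diagonal]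
  nlinarith [mul_le_mul_of_nonneg_right (hd i) (sq_nonneg ((Uᵀ *ᵥ x) i))]

theorem eig_le (U : Matrix N N ℝ) (d : N → ℝ) (h1 : Uᵀ * U = 1) (h2 : U * Uᵀ = 1) (r : ℕ) (hr : 1 ≤ r)
    (w : ℝ) (hw0 : 0 ≤ w) (hw : trace ((U * diagonal d * Uᵀ) ^ (2 * r)) ≤ w ^ (2 * r)) (i : N) :
    d i ≤ w := by
  rw [trace_pow_eq U d h1 h2] at hw
  have h3 : |d i| ^ (2 * r) ≤ w ^ (2 * r) := by
    rw [(even_two_mul r).pow_abs]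
    refine le_trans ?_ hw
    exact Finset.single_le_sum (f := fun i => d i ^ (2 * r))
      (fun j _ => (even_two_mul r).pow_nonneg _) (Finset.mem_univ i)
  have := (pow_le_pow_iff_left₀ (abs_nonneg _) hw0 (by omega)).1 h3
  exact (le_abs_self _).trans this

theorem exists_w (H : Matrix N N ℝ) (hH : Hᵀ = H) (r : ℕ) (hr : 1 ≤ r) :
    ∃ w : ℝ, 0 ≤ w ∧ (∀ x : N → ℝ, x ⬝ᵥ (H *ᵥ x) ≤ w * ns x) ∧ w ^ (2 * r) = trace (H ^ (2 * r)) := by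
  obtain ⟨U, d, hU1, hU2, rfl⟩ := spec H hH
  have h0 : 0 ≤ trace ((U * diagonal d * Uᵀ) ^ (2 * r)) := by
    rw [trace_pow_eq U d hU1 hU2]
    exact Finset.sum_nonneg fun j _ => (even_two_mul r).pow_nonneg _
  have hw : (trace ((U * diagonal d * Uᵀ) ^ (2 * r)) ^ (((2 * r : ℕ) : ℝ)⁻¹)) ^ (2 * r)
      = trace ((U * diagonal d * Uᵀ) ^ (2 * r)) := Real.rpow_inv_natCast_pow h0 (by omega)
  have hw0 : 0 ≤ trace ((U * diagonal d * Uᵀ) ^ (2 * r)) ^ (((2 * r : ℕ) : ℝ)⁻¹) :=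
    Real.rpow_nonneg h0 _
  exact ⟨_, hw0, rayleigh U d hU2 _ (eig_le U d hU1 hU2 r hr _ hw0 hw.ge), hw⟩

theorem add_pow_le2 (a b : ℝ) (ha : 0 ≤ a) (hb : 0 ≤ b) (p : ℕ) :
    (a + b) ^ p ≤ (2 * a) ^ p + (2 * b) ^ p := by
  rcases le_total a b with h | h
  · have : (a + b) ^ p ≤ (2 * b) ^ p := by
      refine pow_le_pow_left₀ (by positivity) (by linarith) _
    have : 0 ≤ (2 * a) ^ p := by positivity
    linarith
  · have : (a + b) ^ p ≤ (2 * a) ^ p := by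
      refine pow_le_pow_left₀ (by positivity) (by linarith) _
    have : 0 ≤ (2 * b) ^ p := by positivity
    linarith

theorem many_moment (hc : ∀ t s, t ≠ s → ∀ M P, φ t M * φ s P = φ s P * φ t M)
    (hT : ∀ t M, φ t Mᵀ = (φ t M)ᵀ) (hm : 2 ≤ Fintype.card T) (hmn : Fintype.card T ≤ n)
    (r p : ℕ) (hr : 1 ≤ r) (hpr : p = 2 * r) (hpn : p ≤ n) :
    ∑ A : Tr n → Bool, trace (HM φ A ^ (2 * p))
      ≤ Fintype.card (Tr n → Bool) * (12 * n * Fintype.card N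
        * (4096 * p * n ^ 3 * (Fintype.card T : ℝ) ^ 2) ^ p) := by
  choose w hw0 hw hwp using fun A : Tr n → Bool => exists_w (H1 A) (H1_symm A) r hr
  have hm' : (2 : ℝ) ≤ Fintype.card T := by exact_mod_cast hm
  have hmn' : (Fintype.card T : ℝ) ≤ n := by exact_mod_cast hmn
  have hpn' : (p : ℝ) ≤ n := by exact_mod_cast hpn
  have hp1 : (1 : ℝ) ≤ p := by exact_mod_cast (by omega : 1 ≤ p)
  have h1 := one_moment (n := n) (by omega) r hr (by omega)
  simp only [← hwp] at h1
  rw [← hpr] at h1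
  have h := closing (XB (BM φ)) (XB_self _) (XB_comm _ (BM_comm φ hc)) (XB_symm _ (BM_symm φ hc hT))
    (fun A => 32 * n ^ 3 * (Fintype.card T : ℝ) ^ 2 + 4 * n * (Fintype.card T : ℝ) ^ 2 * w A)
    (2 * (n + Fintype.card T) * (Fintype.card T - 2))
    (fun A => by have := hw0 A; positivity)
    (mul_nonneg (by positivity) (by linarith))
    (fun A v => many_V φ hc hT hm hmn A (w A) (hw0 A) (hw A) v) p (by omega)
  refine h.trans ?_
  generalize (Fintype.card T : ℝ) = m at *
  have hcN0 : (0 : ℝ) ≤ Fintype.card N := Nat.cast_nonneg _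
  generalize (Fintype.card N : ℝ) = cN at *
  have hn0 : (0 : ℝ) ≤ n := by linarith
  have hn1 : (1 : ℝ) ≤ n := by linarith
  have e1 : (16 * (p : ℝ) * (2 * (n + m) * (m - 2))) ^ (2 * p) ≤ (4096 * p * n ^ 3 * m ^ 2) ^ p := by
    rw [pow_mul]
    refine pow_le_pow_left₀ (by positivity) ?_ _
    have : 16 * (p : ℝ) * (2 * (n + m) * (m - 2)) ≤ 16 * p * (2 * (n + n) * m) := by
      gcongr
      linarith
    have h0 : 0 ≤ 16 * (p : ℝ) * (2 * (n + m) * (m - 2)) :=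
      mul_nonneg (by positivity) (mul_nonneg (by positivity) (by linarith))
    calc (16 * (p : ℝ) * (2 * (n + m) * (m - 2))) ^ 2 ≤ (16 * p * (2 * (n + n) * m)) ^ 2 := by gcongr
      _ = 4096 * p * n ^ 2 * m ^ 2 * p := by ring
      _ ≤ 4096 * p * n ^ 2 * m ^ 2 * n := by gcongr
      _ = _ := by ring
  have e2 : ∀ A, (16 * (p : ℝ) * (32 * n ^ 3 * m ^ 2 + 4 * n * m ^ 2 * w A)) ^ p
      ≤ (4096 * p * n ^ 3 * m ^ 2) ^ p + (128 * p * n * m ^ 2) ^ p * w A ^ p := by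
    intro A
    have := hw0 A
    rw [mul_add]
    refine (add_pow_le2 _ _ (by positivity) (by positivity) p).trans ?_
    rw [← mul_pow]
    refine add_le_add (pow_le_pow_left₀ (by positivity) ?_ _) (le_of_eq ?_)
    · have : 0 ≤ p * (n : ℝ) ^ 3 * m ^ 2 := by positivity
      linarith
    · congr 1; ring
  have e3 : ∑ A, ((16 * (p : ℝ) * (32 * n ^ 3 * m ^ 2 + 4 * n * m ^ 2 * w A)) ^ p
        + (16 * (p : ℝ) * (2 * (n + m) * (m - 2))) ^ (2 * p))
      ≤ Fintype.card (Tr n → Bool) * (6 * n * (4096 * p * n ^ 3 * m ^ 2) ^ p) := by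
    refine (Finset.sum_le_sum fun A _ => add_le_add (e2 A) e1).trans ?_
    rw [Finset.sum_add_distrib, Finset.sum_add_distrib, ← Finset.mul_sum, Finset.sum_const,
      Finset.card_univ, nsmul_eq_mul]
    have f1 : (128 * p * n * m ^ 2) ^ p * ∑ A, w A ^ p
        ≤ (128 * p * n * m ^ 2) ^ p * (Fintype.card (Tr n → Bool) * (4 * n * (16 * (n : ℝ) ^ 2) ^ p)) := by
      gcongr
    have f2 : (128 * p * n * m ^ 2) ^ p * (16 * (n : ℝ) ^ 2) ^ p ≤ (4096 * p * n ^ 3 * m ^ 2) ^ p := by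
      rw [← mul_pow]
      refine pow_le_pow_left₀ (by positivity) ?_ _
      have : 0 ≤ p * (n : ℝ) ^ 3 * m ^ 2 := by positivity
      nlinarith
    have f3 : (0 : ℝ) ≤ Fintype.card (Tr n → Bool) := Nat.cast_nonneg _
    generalize (Fintype.card (Tr n → Bool) : ℝ) = cA at *
    have f4 : cA * (4 * n) * ((128 * p * n * m ^ 2) ^ p * (16 * (n : ℝ) ^ 2) ^ p)
      ≤ cA * (4 * n) * (4096 * p * n ^ 3 * m ^ 2) ^ p := by gcongr
    have f5 : 0 ≤ cA * (n - 1) * (4096 * p * n ^ 3 * m ^ 2) ^ p :=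
      mul_nonneg (mul_nonneg f3 (by linarith)) (by positivity)
    linarith
  calc _ ≤ 2 * cN * (Fintype.card (Tr n → Bool) * (6 * n * (4096 * p * n ^ 3 * m ^ 2) ^ p)) := by gcongr
    _ = _ := by ring
end many
end S18

namespace S18
open Matrix

section site
variable {n m : ℕ}

/-- one-site operators -/
noncomputable def siteM (t : Fin m) (M : Matrix (Fin n) (Fin n) ℝ) :
    Matrix (Fin m → Fin n) (Fin m → Fin n) ℝ :=
  Matrix.of fun I J => ∑ k, if Function.update I t k = J then M (I t) k else 0

theorem siteM_apply (t : Fin m) (M : Matrix (Fin n) (Fin n) ℝ) (I J : Fin m → Fin n) :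
    siteM t M I J = if ∀ r, r ≠ t → I r = J r then M (I t) (J t) else 0 := by
  simp only [siteM, Matrix.of_apply, Function.update_eq_iff, ite_and]
  simp

theorem siteM_mulVec (t : Fin m) (M : Matrix (Fin n) (Fin n) ℝ) (f : (Fin m → Fin n) → ℝ)
    (I : Fin m → Fin n) :
    (siteM t M *ᵥ f) I = ∑ k, M (I t) k * f (Function.update I t k) := by
  simp only [mulVec, dotProduct, siteM, Matrix.of_apply, Finset.sum_mul]
  rw [Finset.sum_comm]
  simp [ite_mul]

theorem siteM_mul (t : Fin m) (M P : Matrix (Fin n) (Fin n) ℝ) :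
    siteM t (M * P) = siteM t M * siteM t P := by
  apply Matrix.mulVec_injective
  funext f
  rw [← Matrix.mulVec_mulVec]
  funext I
  simp only [siteM_mulVec, Function.update_idem, Function.update_self, Matrix.mul_apply,
    Finset.sum_mul, Finset.mul_sum]
  rw [Finset.sum_comm]
  simp only [mul_assoc]

theorem siteM_one (t : Fin m) : siteM (n := n) t 1 = 1 := by
  apply Matrix.mulVec_injective
  funext f
  funext I
  simp [siteM_mulVec, Matrix.one_apply]

theorem siteM_transpose (t : Fin m) (M : Matrix (Fin n) (Fin n) ℝ) : siteM t Mᵀ = (siteM t M)ᵀ := by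
  ext I J
  rw [Matrix.transpose_apply, siteM_apply, siteM_apply, Matrix.transpose_apply]
  simp only [eq_comm]

theorem siteM_comm (t s : Fin m) (h : t ≠ s) (M P : Matrix (Fin n) (Fin n) ℝ) :
    siteM t M * siteM s P = siteM s P * siteM t M := by
  apply Matrix.mulVec_injective
  funext f
  rw [← Matrix.mulVec_mulVec, ← Matrix.mulVec_mulVec]
  funext I
  simp only [siteM_mulVec, Function.update_of_ne h, Function.update_of_ne h.symm, Finset.mul_sum]
  rw [Finset.sum_comm]
  refine Finset.sum_congr rfl fun k _ => Finset.sum_congr rfl fun l _ => ?_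
  rw [Function.update_comm h]
  ring

/-- site algebra homomorphisms -/
noncomputable def site (t : Fin m) :
    Matrix (Fin n) (Fin n) ℝ →ₐ[ℝ] Matrix (Fin m → Fin n) (Fin m → Fin n) ℝ :=
  AlgHom.ofLinearMap
    { toFun := siteM t
      map_add' := by
        intro M P; ext I J; simp only [Matrix.add_apply, siteM_apply]; split_ifs <;> simp
      map_smul' := by
        intro c M; ext I J; simp only [Matrix.smul_apply, siteM_apply, RingHom.id_apply]
        split_ifs <;> simp }
    (siteM_one t) (siteM_mul t)

theorem site_eq (t : Fin m) (M : Matrix (Fin n) (Fin n) ℝ) : site t M = siteM t M := rfl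

theorem site_comm : ∀ t s : Fin m, t ≠ s → ∀ M P : Matrix (Fin n) (Fin n) ℝ,
    site t M * site s P = site s P * site t M := siteM_comm

theorem site_transpose : ∀ (t : Fin m) (M : Matrix (Fin n) (Fin n) ℝ), site t Mᵀ = (site t M)ᵀ :=
  siteM_transpose

/-- product vectors -/
def pv (y : Fin m → Fin n → ℝ) (I : Fin m → Fin n) : ℝ := ∏ r, y r (I r)

theorem site_pv (t : Fin m) (M : Matrix (Fin n) (Fin n) ℝ) (y : Fin m → Fin n → ℝ) :
    site t M *ᵥ pv y = pv (Function.update y t (M *ᵥ y t)) := by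
  funext I
  rw [site_eq, siteM_mulVec, pv, ← Finset.mul_prod_erase _ _ (Finset.mem_univ t)]
  simp only [Function.update_self, mulVec, dotProduct, Finset.sum_mul]
  refine Finset.sum_congr rfl fun k _ => ?_
  rw [pv, ← Finset.mul_prod_erase _ _ (Finset.mem_univ t), Function.update_self, mul_assoc]
  congr 2
  refine Finset.prod_congr rfl fun r hr => ?_
  have := Finset.ne_of_mem_erase hr
  rw [Function.update_of_ne this, Function.update_of_ne this]

theorem pv_dot (y y' : Fin m → Fin n → ℝ) : pv y ⬝ᵥ pv y' = ∏ r, y r ⬝ᵥ y' r := by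
  simp only [dotProduct, pv, ← Finset.prod_mul_distrib]
  rw [Finset.prod_univ_sum, Fintype.piFinset_univ]

theorem two_site (t s : Fin m) (h : s ≠ t) (M P : Matrix (Fin n) (Fin n) ℝ) (x : Fin n → ℝ) :
    pv (fun _ : Fin m => x) ⬝ᵥ ((site t M * site s P) *ᵥ pv (fun _ => x))
      = (x ⬝ᵥ (M *ᵥ x)) * (x ⬝ᵥ (P *ᵥ x)) * ns x ^ (m - 2) := by
  rw [← Matrix.mulVec_mulVec, site_pv, site_pv, pv_dot, ← Finset.mul_prod_erase _ _ (Finset.mem_univ t),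
    ← Finset.mul_prod_erase _ _ (Finset.mem_erase.2 ⟨h, Finset.mem_univ s⟩), Function.update_self,
    Function.update_of_ne h.symm, Function.update_of_ne h, Function.update_self, mul_assoc]
  congr 2
  rw [Finset.prod_congr rfl (g := fun _ => ns x)]
  · rw [Finset.prod_const, Finset.card_erase_of_mem (Finset.mem_erase.2 ⟨h, Finset.mem_univ s⟩),
      Finset.card_erase_of_mem (Finset.mem_univ t), Finset.card_univ, Fintype.card_fin, Nat.sub_sub]
  · intro r hr
    have h1 := Finset.ne_of_mem_erase hr
    have h2 := Finset.ne_of_mem_erase (Finset.mem_of_mem_erase hr)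
    rw [Function.update_of_ne h2, Function.update_of_ne h1]
    rfl

theorem BM_pv (M : Matrix (Fin n) (Fin n) ℝ) (x : Fin n → ℝ) :
    pv (fun _ : Fin m => x) ⬝ᵥ (BM (site (n := n)) M M *ᵥ pv (fun _ => x))
      = m * (m - 1) * (x ⬝ᵥ (M *ᵥ x)) ^ 2 * ns x ^ (m - 2) := by
  rw [BM_eq, Matrix.sum_mulVec, dotProduct_sum]
  simp only [Matrix.sum_mulVec, dotProduct_sum]
  have : ∀ t s : Fin m, pv (fun _ : Fin m => x) ⬝ᵥ ((if s = t then 0 else site t M * site s M) *ᵥ pv (fun _ => x))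
      = (x ⬝ᵥ (M *ᵥ x)) ^ 2 * ns x ^ (m - 2) - if s = t then (x ⬝ᵥ (M *ᵥ x)) ^ 2 * ns x ^ (m - 2) else 0 := by
    intro t s
    split_ifs with h
    · simp
    · rw [two_site t s h]; ring
  simp only [this, Finset.sum_sub_distrib]
  simp
  ring

theorem sE_quad (i k : Fin n) (x : Fin n → ℝ) : x ⬝ᵥ (sE i k *ᵥ x) = x i * x k := by
  have h : ∀ i k : Fin n, x ⬝ᵥ (El i k *ᵥ x) = x i * x k := by
    intro i k
    simp [El, dotProduct, mulVec, single_apply, ite_and, Finset.mul_sum]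
  rw [sE, Matrix.smul_mulVec, Matrix.add_mulVec, dotProduct_smul, dotProduct_add, h, h, smul_eq_mul]
  ring

theorem Al_quad (A : Tr n → Bool) (l : Fin n) (x : Fin n → ℝ) :
    x ⬝ᵥ (Al A l *ᵥ x) = ∑ i, ∑ k, sg A ![l, i, k] * (x i * x k) := by
  rw [Al_eq, Matrix.sum_mulVec, dotProduct_sum]
  refine Finset.sum_congr rfl fun i _ => ?_
  rw [Matrix.sum_mulVec, dotProduct_sum]
  refine Finset.sum_congr rfl fun k _ => ?_
  rw [Matrix.smul_mulVec, dotProduct_smul, sE_quad, smul_eq_mul]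

theorem HM_pv (hm : 2 ≤ m) (A : Tr n → Bool) (x : Fin n → ℝ) :
    pv (fun _ : Fin m => x) ⬝ᵥ (HM (site (n := n)) A *ᵥ pv (fun _ => x))
      = m * (m - 1) * (∑ l, (∑ i, ∑ k, sg A ![l, i, k] * (x i * x k)) ^ 2) * ns x ^ (m - 2)
        - m * (m - 1) * n * ns x ^ m := by
  rw [HM, Hc_XB, Matrix.sub_mulVec, dotProduct_sub, Matrix.sum_mulVec, Matrix.sum_mulVec,
      dotProduct_sum, dotProduct_sum]
  simp only [BM_pv, Al_quad]
  have h2 : ∑ a : Tr n, (x ⬝ᵥ (sm a *ᵥ x)) ^ 2 = n * ns x ^ 2 := by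
    simp only [sm, sE_quad]
    rw [sum3 (fun _ i k => (x i * x k) ^ 2)]
    simp only [Finset.sum_const, Finset.card_univ, Fintype.card_fin, nsmul_eq_mul]
    rw [sq (ns x), ns_eq, Finset.sum_mul_sum]
    simp only [mul_pow]
  rw [← Finset.sum_mul, ← Finset.sum_mul, ← Finset.mul_sum, ← Finset.mul_sum, h2]
  have h3 : ns x ^ m = ns x ^ 2 * ns x ^ (m - 2) := by rw [← pow_add]; congr 1; omega
  rw [h3]
  ring
end site

section pseudo
variable {n m : ℕ}
open MvPolynomial

/-- squared norm polynomial -/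
noncomputable def r2 (n : ℕ) : MvPolynomial (Fin n) ℝ := ∑ i, X i ^ 2

/-- slices -/
noncomputable def GG (A : Tr n → Bool) (l : Fin n) : MvPolynomial (Fin n) ℝ :=
  ∑ i, ∑ k, C (sg A ![l, i, k]) * (X i * X k)

theorem r2_deg : (r2 n).totalDegree ≤ 2 := by
  refine totalDegree_finsetSum_le fun i _ => ?_
  rw [totalDegree_X_pow]

theorem GG_deg (A : Tr n → Bool) (l : Fin n) : (GG A l).totalDegree ≤ 2 := by
  refine totalDegree_finsetSum_le fun i _ => totalDegree_finsetSum_le fun k _ => ?_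
  refine (totalDegree_mul _ _).trans ?_
  rw [totalDegree_C, zero_add]
  refine (totalDegree_mul _ _).trans ?_
  rw [totalDegree_X, totalDegree_X]

theorem eval_r2 (x : Fin n → ℝ) : eval x (r2 n) = ns x := by
  simp [r2, ns_eq]

theorem eval_GG (A : Tr n → Bool) (l : Fin n) (x : Fin n → ℝ) :
    eval x (GG A l) = ∑ i, ∑ k, sg A ![l, i, k] * (x i * x k) := by
  simp [GG]

theorem E_r2 (E : MvPolynomial (Fin n) ℝ →ₗ[ℝ] ℝ)
    (h : ∀ p : MvPolynomial (Fin n) ℝ, p.totalDegree ≤ 2 * m - 2 → E (p * (r2 n - 1)) = 0)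
    (g : MvPolynomial (Fin n) ℝ) (d : ℕ) (hg : g.totalDegree ≤ 2 * d) (j : ℕ) (hj : d + j ≤ m) :
    E (g * r2 n ^ j) = E g := by
  induction j with
  | zero => simp
  | succ j ih =>
    have h1 : (g * r2 n ^ j).totalDegree ≤ 2 * m - 2 := by
      refine (totalDegree_mul _ _).trans ?_
      have := totalDegree_pow (r2 n) j
      have h2 : j * (r2 n).totalDegree ≤ j * 2 := Nat.mul_le_mul le_rfl r2_deg
      omega
    have := h _ h1
    rw [mul_sub, mul_one, map_sub, sub_eq_zero, mul_assoc, ← pow_succ] at this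
    rw [this]
    exact ih (by omega)

theorem pseudo (hm : 2 ≤ m) (A : Tr n → Bool) (p : ℕ) (hp : 1 ≤ p) (Λ τ : ℝ) (hΛ : 0 ≤ Λ) (hτ : 0 < τ)
    (hH : trace (HM (site (n := n) (m := m)) A ^ (2 * p)) ≤ Λ ^ (2 * p))
    (E : MvPolynomial (Fin n) ℝ →ₗ[ℝ] ℝ) (h1 : E 1 = 1)
    (h2 : ∀ p : MvPolynomial (Fin n) ℝ, p.totalDegree ≤ m → 0 ≤ E (p * p))
    (h3 : ∀ p : MvPolynomial (Fin n) ℝ, p.totalDegree ≤ 2 * m - 2 → E (p * (r2 n - 1)) = 0) :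
    E (∑ K : Fin 3 → Fin n, C (sg A K) * ∏ l, X (K l)) ≤ (τ ^ 2 + (n + Λ / (m * (m - 1)))) / (2 * τ) := by
  have hm' : (2 : ℝ) ≤ m := by exact_mod_cast hm
  have hmm : (0 : ℝ) < m * (m - 1) := mul_pos (by linarith) (by linarith)
  have hEr : ∀ j, j ≤ m → E (r2 n ^ j) = 1 := by
    intro j hj
    have := E_r2 E h3 1 0 (by simp) j (by omega)
    rwa [one_mul, h1] at this
  obtain ⟨U, d, hU1, hU2, hUd⟩ := spec _ (HM_symm (site (n := n) (m := m)) site_comm site_transpose A)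
  have hd : ∀ i, d i ≤ Λ := by
    rw [hUd] at hH
    exact eig_le U d hU1 hU2 p hp Λ hΛ hH
  let Y : (Fin m → Fin n) → MvPolynomial (Fin n) ℝ := fun i => ∑ I, C (U I i) * ∏ r, X (I r)
  have hYd : ∀ i, (Y i).totalDegree ≤ m := by
    intro i
    refine totalDegree_finsetSum_le fun I _ => ?_
    refine (totalDegree_mul _ _).trans ?_
    rw [totalDegree_C, zero_add]
    refine (totalDegree_finsetProd _ _).trans ?_
    simp
  have hYe : ∀ i x, eval x (Y i) = (Uᵀ *ᵥ pv (fun _ => x)) i := by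
    intro i x
    simp [Y, mulVec, dotProduct, pv]
  have e1 : ∑ i, Y i * Y i = r2 n ^ m := by
    apply MvPolynomial.funext
    intro x
    simp only [map_sum, map_mul, map_pow, hYe, eval_r2]
    have : ns (Uᵀ *ᵥ pv (fun _ => x)) = ns x ^ m := by
      rw [ns_mulVec, transpose_transpose, hU2, Matrix.one_mulVec, pv_dot]
      simp [ns]
    rw [← this, ns, dotProduct]
  have e2 : ∑ i, d i • (Y i * Y i)
      = (m * (m - 1) : ℝ) • ((∑ l, GG A l * GG A l) * r2 n ^ (m - 2)) - (m * (m - 1) * n : ℝ) • r2 n ^ m := by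
    apply MvPolynomial.funext
    intro x
    simp only [map_sum, map_mul, map_pow, map_sub, smul_eval, hYe, eval_r2, eval_GG]
    have h := HM_pv hm A x
    rw [hUd, ← Matrix.mulVec_mulVec, ← Matrix.mulVec_mulVec, dotProduct_mulVec, ← Matrix.mulVec_transpose] at h
    simp only [dotProduct, mulVec_diagonal] at h
    simp only [← sq]
    rw [← mul_assoc, ← h]
    refine Finset.sum_congr rfl fun i _ => ?_
    ring
  have e3 : E (∑ i, d i • (Y i * Y i)) ≤ Λ := by
    calc E (∑ i, d i • (Y i * Y i)) = ∑ i, d i * E (Y i * Y i) := by simp [map_sum]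
      _ ≤ ∑ i, Λ * E (Y i * Y i) :=
        Finset.sum_le_sum fun i _ => mul_le_mul_of_nonneg_right (hd i) (h2 _ (hYd i))
      _ = Λ * E (∑ i, Y i * Y i) := by rw [← Finset.mul_sum, map_sum]
      _ = Λ := by rw [e1, hEr m le_rfl, mul_one]
  have hGd : (∑ l, GG A l * GG A l).totalDegree ≤ 2 * 2 := by
    refine totalDegree_finsetSum_le fun l _ => ?_
    refine (totalDegree_mul _ _).trans ?_
    have := GG_deg A l
    omega
  rw [e2, map_sub, map_smul, map_smul, hEr m le_rfl, E_r2 E h3 _ 2 hGd (m - 2) (by omega), smul_eq_mul,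
    smul_eq_mul, mul_one] at e3
  have e4 : E (∑ l, GG A l * GG A l) ≤ n + Λ / (m * (m - 1)) := by
    rw [← sub_le_iff_le_add', le_div_iff₀ hmm]
    linarith
  have e5 : 0 ≤ ∑ l, E ((τ • X l - GG A l) * (τ • X l - GG A l)) := by
    refine Finset.sum_nonneg fun l _ => h2 _ ?_
    refine (totalDegree_sub _ _).trans ?_
    have a1 := GG_deg A l
    have a2 : (τ • (X l : MvPolynomial (Fin n) ℝ)).totalDegree ≤ 1 :=
      (totalDegree_smul_le _ _).trans (by rw [totalDegree_X])
    exact max_le (by omega) (by omega)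
  have e6 : ∑ l, (τ • X l - GG A l) * (τ • X l - GG A l)
      = τ ^ 2 • r2 n - (2 * τ) • (∑ K : Fin 3 → Fin n, C (sg A K) * ∏ l, X (K l)) + ∑ l, GG A l * GG A l := by
    have hf : (∑ K : Fin 3 → Fin n, C (sg A K) * ∏ l, X (K l) : MvPolynomial (Fin n) ℝ)
        = ∑ l, X l * GG A l := by
      have : ∀ K : Fin 3 → Fin n, (C (sg A K) * ∏ l, X (K l) : MvPolynomial (Fin n) ℝ)
          = (fun l i k => C (sg A ![l, i, k]) * (X l * X i * X k)) (K 0) (K 1) (K 2) := by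
        intro K
        have hb : ![K 0, K 1, K 2] = K := by ext i; fin_cases i <;> rfl
        simp only [hb, Fin.prod_univ_three]
      rw [Finset.sum_congr rfl fun K _ => this K,
        sum3 (fun l i k => (C (sg A ![l, i, k]) * (X l * X i * X k) : MvPolynomial (Fin n) ℝ))]
      simp only [GG, Finset.mul_sum]
      refine Finset.sum_congr rfl fun l _ => Finset.sum_congr rfl fun i _ =>
        Finset.sum_congr rfl fun k _ => ?_
      ring
    rw [hf, r2, Finset.smul_sum, Finset.smul_sum, ← Finset.sum_sub_distrib, ← Finset.sum_add_distrib]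
    refine Finset.sum_congr rfl fun l _ => ?_
    simp only [smul_eq_C_mul, map_pow, map_mul, map_ofNat]
    ring
  rw [← map_sum, e6, map_add, map_sub, map_smul, map_smul, smul_eq_mul, smul_eq_mul] at e5
  have hr1 := hEr 1 (by omega)
  rw [pow_one] at hr1
  rw [hr1] at e5
  rw [le_div_iff₀ (by positivity)]
  linarith
end pseudo
end S18

namespace S18
open Matrix

section final

theorem trace_even_nonneg {N : Type*} [Fintype N] [DecidableEq N] (H : Matrix N N ℝ) (hH : Hᵀ = H)
    (p : ℕ) : 0 ≤ trace (H ^ (2 * p)) := by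
  obtain ⟨U, d, hU1, hU2, rfl⟩ := spec H hH
  rw [trace_pow_eq U d hU1 hU2]
  exact Finset.sum_nonneg fun j _ => (even_two_mul p).pow_nonneg _

/-- Markov inequality for counting -/
theorem markov {Ω : Type*} [Fintype Ω] (f : Ω → ℝ) (hf : ∀ A, 0 ≤ f A) (a b : ℝ) (ha : 0 < a)
    (h : ∑ A, f A ≤ Fintype.card Ω * b) (P : Ω → Prop) (hP : ∀ A, f A ≤ a → P A) :
    (Fintype.card Ω : ℝ) * (1 - b / a) ≤ Nat.card {A // P A} := by
  classical
  have h1 : ((Finset.univ.filter fun A => ¬ P A).card : ℝ) * a ≤ Fintype.card Ω * b := by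
    refine le_trans ?_ h
    rw [← nsmul_eq_mul]
    refine (Finset.card_nsmul_le_sum _ f a fun A hA => ?_).trans
      (Finset.sum_le_univ_sum_of_nonneg hf)
    by_contra hlt
    exact (Finset.mem_filter.1 hA).2 (hP A (le_of_lt (not_le.1 hlt)))
  have h2 : (Nat.card {A // P A} : ℝ) = (Finset.univ.filter fun A => P A).card := by
    rw [Nat.card_eq_fintype_card, Fintype.card_subtype]
  have h3 : ((Finset.univ.filter fun A => P A).card : ℝ) + (Finset.univ.filter fun A => ¬ P A).card
      = Fintype.card Ω := by
    exact_mod_cast Finset.card_filter_add_card_filter_not (s := Finset.univ) P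
  rw [h2, mul_sub, mul_one, mul_div_assoc']
  have : ((Finset.univ.filter fun A => ¬ P A).card : ℝ) ≤ Fintype.card Ω * b / a := by
    rwa [le_div_iff₀ ha]
  linarith

/-- probability arithmetic -/
theorem prob_arith (n m p : ℕ) (hn : 1000 ≤ (n : ℝ)) (hm : 2 ≤ m) (hp : (m : ℝ) * Real.log n ≤ p)
    (Y : ℝ) (hY : 0 < Y) :
    (12 * n * ((n ^ m : ℕ) : ℝ) * Y ^ p) / (9 * Y) ^ p ≤ (n : ℝ) ^ (-(1 / 2 : ℝ)) := by
  have hn0 : (0 : ℝ) < n := by linarith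
  have h9 : ((n : ℝ) ^ m) ^ 2 ≤ 9 ^ p := by
    have e1 : Real.exp 2 ≤ 9 := by
      have := Real.exp_one_lt_d9
      have h2 : Real.exp 2 = Real.exp 1 * Real.exp 1 := by rw [← Real.exp_add]; norm_num
      have h3 := Real.exp_pos 1
      rw [h2]; nlinarith
    calc ((n : ℝ) ^ m) ^ 2 = Real.exp (Real.log (((n : ℝ) ^ m) ^ 2)) := (Real.exp_log (by positivity)).symm
      _ = Real.exp (2 * (m * Real.log n)) := by rw [Real.log_pow, Real.log_pow]; norm_num
      _ ≤ Real.exp (2 * p) := by apply Real.exp_le_exp.2; linarith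
      _ = Real.exp 2 ^ p := by rw [mul_comm, Real.exp_nat_mul]
      _ ≤ 9 ^ p := by gcongr
  have hnm : (n : ℝ) ^ 2 ≤ (n : ℝ) ^ m := pow_le_pow_right₀ (by linarith) hm
  set s := Real.sqrt n with hs
  have hss : s * s = n := Real.mul_self_sqrt hn0.le
  have hs0 : 0 < s := Real.sqrt_pos.2 hn0
  have hs12 : 12 ≤ s := by
    apply Real.le_sqrt_of_sq_le; linarith
  rw [Real.rpow_neg hn0.le, ← Real.sqrt_eq_rpow, ← hs, mul_pow, Nat.cast_pow,
    mul_div_mul_right _ _ (by positivity), div_le_iff₀ (by positivity), inv_mul_eq_div,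
    le_div_iff₀ hs0]
  refine le_trans ?_ h9
  rw [sq ((n : ℝ) ^ m)]
  have h1 : 12 * (n : ℝ) * s ≤ (n : ℝ) ^ 2 := by
    calc 12 * (n : ℝ) * s ≤ s * n * s := by gcongr
      _ = _ := by rw [sq, ← hss]; ring
  calc 12 * (n : ℝ) * n ^ m * s = (12 * n * s) * n ^ m := by ring
    _ ≤ n ^ m * n ^ m := by gcongr; exact h1.trans hnm

/-- size arithmetic -/
theorem size_arith (n m p : ℕ) (hn : 1000 ≤ (n : ℝ)) (hm : 2 ≤ m) (hL : 1 ≤ Real.log n)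
    (hmn : (2 * m : ℝ) * Real.log n ≤ n) (hp : (p : ℝ) ≤ 2 * (m * Real.log n)) (Λ τ : ℝ) (hΛ : 0 ≤ Λ)
    (hΛ2 : Λ ^ 2 = 9 * (4096 * p * n ^ 3 * (m : ℝ) ^ 2))
    (hτ : τ = 1000 * (n : ℝ) ^ ((3 : ℝ) / 4) * Real.log n ^ ((5 : ℝ) / 2) /
                ((2 * m : ℝ)) ^ ((1 : ℝ) / 4)) :
    0 < τ ∧ n + Λ / (m * (m - 1)) ≤ τ ^ 2 := by
  have hn0 : (0 : ℝ) < n := by linarith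
  have hm' : (2 : ℝ) ≤ m := by exact_mod_cast hm
  have hL0 : 0 < Real.log n := by linarith
  have ha : 0 < (n : ℝ) ^ ((3 : ℝ) / 4) := Real.rpow_pos_of_pos hn0 _
  have hl : Real.log n ≤ Real.log n ^ ((5 : ℝ) / 2) := by
    conv_lhs => rw [← Real.rpow_one (Real.log n)]
    exact Real.rpow_le_rpow_of_exponent_le hL (by norm_num)
  have hb : 0 < (2 * m : ℝ) ^ ((1 : ℝ) / 4) := Real.rpow_pos_of_pos (by linarith) _
  have ha4 : ((n : ℝ) ^ ((3 : ℝ) / 4)) ^ 4 = n ^ 3 := by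
    rw [← Real.rpow_natCast, ← Real.rpow_mul hn0.le, ← Real.rpow_natCast]; norm_num
  have hb4 : ((2 * m : ℝ) ^ ((1 : ℝ) / 4)) ^ 4 = 2 * m := by
    rw [← Real.rpow_natCast, ← Real.rpow_mul (by linarith)]; norm_num
  generalize (n : ℝ) ^ ((3 : ℝ) / 4) = a at *
  generalize Real.log n ^ ((5 : ℝ) / 2) = l at *
  generalize (2 * m : ℝ) ^ ((1 : ℝ) / 4) = b at *
  generalize Real.log n = L at *
  have hl0 : 0 < l := by linarith
  refine ⟨by rw [hτ]; positivity, ?_⟩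
  obtain ⟨S, hS⟩ : ∃ S, S = a ^ 2 / b ^ 2 := ⟨_, rfl⟩
  have hS0 : 0 < S := by rw [hS]; positivity
  have hS2 : S ^ 2 * (2 * m) = n ^ 3 := by
    rw [hS, ← hb4, ← ha4]; field_simp
  have hτ2 : τ ^ 2 = 1000000 * l ^ 2 * S := by
    rw [hτ, hS]; field_simp; norm_num
  have h2m : 2 * (m : ℝ) ≤ n := by nlinarith
  have k1 : (n : ℝ) ≤ S := by
    refine le_of_sq_le_sq ?_ hS0.le
    have : (n : ℝ) ^ 2 * (2 * m) ≤ S ^ 2 * (2 * m) := by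
      rw [hS2]
      calc (n : ℝ) ^ 2 * (2 * m) ≤ n ^ 2 * n := by gcongr
        _ = _ := by ring
    exact le_of_mul_le_mul_right this (by linarith)
  have hmm : (0 : ℝ) < m * (m - 1) := mul_pos (by linarith) (by linarith)
  have k2 : Λ / (m * (m - 1)) ≤ 768 * L * S := by
    rw [div_le_iff₀ hmm]
    refine le_of_sq_le_sq ?_ (by positivity)
    have e1 : Λ ^ 2 ≤ 9 * (4096 * (2 * (m * L)) * n ^ 3 * (m : ℝ) ^ 2) := by
      rw [hΛ2]; gcongr
    refine e1.trans ?_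
    rw [← hS2]
    have e2 : (m : ℝ) ^ 2 ≤ 4 * (m - 1) ^ 2 := by nlinarith
    have e3 : L ≤ L ^ 2 := by nlinarith
    calc 9 * (4096 * (2 * (m * L)) * (S ^ 2 * (2 * m)) * (m : ℝ) ^ 2)
        = 147456 * S ^ 2 * m ^ 2 * (L * m ^ 2) := by ring
      _ ≤ 147456 * S ^ 2 * m ^ 2 * (L ^ 2 * (4 * (m - 1) ^ 2)) := by gcongr
      _ = (768 * L * S * (m * (m - 1))) ^ 2 := by ring
  rw [hτ2]
  have e4 : L ≤ l ^ 2 := by nlinarith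
  have e5 : S ≤ l ^ 2 * S := by nlinarith
  have e6 : L * S ≤ l ^ 2 * S := by gcongr
  nlinarith
end final
end S18

theorem stmt_18 : ∃ C c : ℝ, 0 < C ∧ 0 < c ∧
    ∀ (n q k : ℕ), C ≤ (n : ℝ) → q = 4 * 2 ^ k → (q : ℝ) * Real.log n ≤ (n : ℝ) →
      1 - (n : ℝ) ^ (-c) ≤
        tprob n 3 (fun A =>
          ∀ E : MvPolynomial (Fin n) ℝ →ₗ[ℝ] ℝ,
            E 1 = 1 →
            (∀ p : MvPolynomial (Fin n) ℝ, p.totalDegree ≤ q / 2 → 0 ≤ E (p * p)) →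
            (∀ p : MvPolynomial (Fin n) ℝ, p.totalDegree ≤ q - 2 →
              E (p * ((∑ i, MvPolynomial.X i ^ 2) - 1)) = 0) →
            E (∑ K : Fin 3 → Fin n, MvPolynomial.C (A K) * ∏ ℓ, MvPolynomial.X (K ℓ)) ≤
              C * (n : ℝ) ^ ((3 : ℝ) / 4) * Real.log n ^ ((5 : ℝ) / 2) /
                (q : ℝ) ^ ((1 : ℝ) / 4)) := by
  refine ⟨1000, 1 / 2, by norm_num, by norm_num, ?_⟩
  intro n q k hn hq hqn
  obtain ⟨m, hmdef⟩ : ∃ m, m = 2 * 2 ^ k := ⟨_, rfl⟩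
  have hqm : q = 2 * m := by rw [hq, hmdef]; ring
  have hm : 2 ≤ m := by
    have : 1 ≤ 2 ^ k := Nat.one_le_two_pow
    omega
  have hm' : (2 : ℝ) ≤ m := by exact_mod_cast hm
  have hn0 : (0 : ℝ) < n := by linarith
  have hL : 1 ≤ Real.log n := by
    rw [Real.le_log_iff_exp_le hn0]
    have := Real.exp_one_lt_d9
    linarith
  have hqm' : (q : ℝ) = 2 * m := by rw [hqm]; push_cast; ring
  have hmn : (2 * m : ℝ) * Real.log n ≤ n := by rw [← hqm']; exact hqn
  obtain ⟨r, hr⟩ : ∃ r, r = ⌈(m : ℝ) * Real.log n / 2⌉₊ := ⟨_, rfl⟩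
  have hmL : 2 ≤ (m : ℝ) * Real.log n := by nlinarith
  have hr1 : (m : ℝ) * Real.log n / 2 ≤ r := by rw [hr]; exact Nat.le_ceil _
  have hr2 : (r : ℝ) < (m : ℝ) * Real.log n / 2 + 1 := by
    rw [hr]; exact Nat.ceil_lt_add_one (by linarith)
  have hr0 : 1 ≤ r := by
    have : (1 : ℝ) ≤ r := by linarith
    exact_mod_cast this
  obtain ⟨p, hpr⟩ : ∃ p, p = 2 * r := ⟨_, rfl⟩
  have hpr' : (p : ℝ) = 2 * r := by rw [hpr]; push_cast; ring
  have hp1 : (m : ℝ) * Real.log n ≤ p := by linarith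
  have hp2 : (p : ℝ) ≤ 2 * (m * Real.log n) := by linarith
  have hpn : p ≤ n := by
    have : (p : ℝ) ≤ n := by linarith
    exact_mod_cast this
  have hmn2 : m ≤ n := by
    have : (m : ℝ) ≤ n := by nlinarith
    exact_mod_cast this
  have hp0 : 1 ≤ p := by omega
  have hp0' : (0 : ℝ) < p := by exact_mod_cast hp0
  have hmom := S18.many_moment (S18.site (n := n) (m := m)) S18.site_comm S18.site_transpose
    (by rw [Fintype.card_fin]; exact hm) (by rw [Fintype.card_fin]; exact hmn2) r p hr0 hpr hpn
  have hcN : Fintype.card (Fin m → Fin n) = n ^ m := by simp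
  rw [Fintype.card_fin, hcN] at hmom
  obtain ⟨Y, hYdef⟩ : ∃ Y : ℝ, Y = 4096 * p * n ^ 3 * (m : ℝ) ^ 2 := ⟨_, rfl⟩
  have hY : 0 < Y := by rw [hYdef]; positivity
  rw [← hYdef] at hmom
  have hΛ2 : Real.sqrt (9 * Y) ^ 2 = 9 * Y := Real.sq_sqrt (by positivity)
  obtain ⟨τ, hτ⟩ : ∃ τ : ℝ, τ = 1000 * (n : ℝ) ^ ((3 : ℝ) / 4) * Real.log n ^ ((5 : ℝ) / 2) /
                ((2 * m : ℝ)) ^ ((1 : ℝ) / 4) := ⟨_, rfl⟩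
  obtain ⟨hτ0, hτR⟩ := S18.size_arith n m p hn hm hL hmn hp2 (Real.sqrt (9 * Y)) τ
    (Real.sqrt_nonneg _) (by rw [hΛ2, hYdef]) hτ
  have hpa := S18.prob_arith n m p hn hm hp1 Y hY
  unfold tprob
  have hcard : (0 : ℝ) < Fintype.card ((Fin 3 → Fin n) → Bool) := by
    exact_mod_cast Fintype.card_pos
  rw [le_div_iff₀ hcard, mul_comm]
  refine le_trans ?_ (S18.markov _ (fun A => S18.trace_even_nonneg _
    (S18.HM_symm (S18.site (n := n) (m := m)) S18.site_comm S18.site_transpose A) p)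
    ((9 * Y) ^ p) _ (by positivity) hmom _ ?_)
  · gcongr
  · intro A hA E h1 h2 h3
    have hps := S18.pseudo hm A p hp0 (Real.sqrt (9 * Y)) τ (Real.sqrt_nonneg _) hτ0
      (by rw [pow_mul (Real.sqrt (9 * Y)), hΛ2]; exact hA) E h1
      (fun P hP => h2 P (by omega)) (fun P hP => h3 P (by omega))
    rw [hqm', ← hτ]
    refine le_trans hps ?_
    rw [div_le_iff₀ (by positivity)]
    nlinarith
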